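/- arXiv:math/0312080 — 3 statements merged into one kernel-verified Lean document; each statement's English description precedes it below -/
import Mathlib

section
/- Equicontinuity of Jordan curves with uniformly bounded Dirichlet energy (Euclidean-target version of the paper's compactness theorem): Let m₁, m₂ be natural numbers, let ζ₁, ζ₂, ζ₃ be three distinct points of the unit circle S¹ ⊆ ℝ², let γₙ : S¹ → ℝ^{m₁} be a sequence of Jordan curves (continuous injective maps), let fₙ : S¹ → ℝ^{m₂} be continuous maps, and set gₙ = (γₙ, fₙ) : S¹ → ℝ^{m₁+m₂}. Assume: (1) inf over n of min{‖γₙ(ζ₁)−γₙ(ζ₂)‖, ‖γₙ(ζ₁)−γₙ(ζ₃)‖, ‖γₙ(ζ₂)−γₙ(ζ₃)‖} is strictly positive; (2) for every μ > 0 there exists ε > 0 such that for every n and all ζ, ζ' ∈ S¹ with ‖gₙ(ζ) − gₙ(ζ')‖ < ε, at least one of the two closed arcs of S¹ with endpoints ζ and ζ' has γₙ-image of diameter less than μ; (3) there exist M > 0 and maps Xₙ from the closed unit disk to ℝ^{m₁+m₂}, continuous on the closed disk and C¹ on the open disk Δ, with Xₙ restricted to S¹ equal to gₙ and with Dirichlet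 energy ∫_Δ (‖∂Xₙ/∂x‖² + ‖∂Xₙ/∂y‖²) dx dy < M for every n. Then the family {γₙ : n ∈ ℕ} is equicontinuous: for every e > 0 there exists δ > 0 such that for every n and all ζ, ζ' ∈ S¹ with ‖ζ − ζ'‖ < δ one has ‖γₙ(ζ) − γₙ(ζ')‖ < e. -/
open Filter Set Metric MeasureTheory

/-- A path in a Banach space whose endpoints are at distance at least `ε` and which is parametrized
by an interval of length at most `c` has energy at least `ε ^ 2 / c`. -/
theorem ofReal_sq_div_le_lintegral_norm_deriv_sq {F : Type*} [NormedAddCommGroup F]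
    [NormedSpace ℝ F] [CompleteSpace F] {h h' : ℝ → F} {a b c ε : ℝ} (hab : a ≤ b)
    (hcont : ContinuousOn h (Icc a b)) (hderiv : ∀ t ∈ Ioo a b, HasDerivAt h (h' t) t)
    (hcont' : ContinuousOn h' (Ioo a b)) (hc : 0 < c) (hbac : b - a ≤ c) (hε : 0 < ε)
    (hend : ε ≤ ‖h b - h a‖) :
    ENNReal.ofReal (ε ^ 2 / c) ≤ ∫⁻ t in Ioo a b, ENNReal.ofReal (‖h' t‖ ^ 2) := by
  by_contra! hlt
  have hmeas : AEStronglyMeasurable h' (volume.restrict (Ioo a b)) :=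
    hcont'.aestronglyMeasurable measurableSet_Ioo
  have hint2 : IntegrableOn (fun t => ‖h' t‖ ^ 2) (Ioo a b) :=
    ⟨hmeas.norm.pow 2, by
      rw [hasFiniteIntegral_iff_ofReal (ae_of_all _ fun t => sq_nonneg _)]
      exact hlt.trans ENNReal.ofReal_lt_top⟩
  have hA : ∫ t in Ioo a b, ‖h' t‖ ^ 2 < ε ^ 2 / c := by
    rw [← ofReal_integral_eq_lintegral_ofReal hint2 (ae_of_all _ fun t => sq_nonneg _)] at hlt
    exact (ENNReal.ofReal_lt_ofReal_iff (by positivity)).1 hlt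
  have hconst : ∀ k : ℝ, IntegrableOn (fun _ : ℝ => k) (Ioo a b) := fun k =>
    integrableOn_const (by simp)
  have hint : IntegrableOn h' (Ioo a b) := by
    refine Integrable.mono' (Integrable.add (hconst 1) hint2) hmeas (ae_of_all _ fun t => ?_)
    simp only [Pi.add_apply]
    nlinarith [sq_nonneg (‖h' t‖ - 1 / 2)]
  have hftc := intervalIntegral.integral_eq_sub_of_hasDerivAt_of_le hab hcont hderiv
    ((intervalIntegrable_iff_integrableOn_Ioo_of_le hab).2 hint)
  rw [intervalIntegral.integral_of_le hab, integral_Ioc_eq_integral_Ioo] at hftc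
  have hle : ∫ t in Ioo a b, ‖h' t‖ ≤
      ∫ t in Ioo a b, (ε / (2 * c) + c / (2 * ε) * ‖h' t‖ ^ 2) := by
    refine integral_mono hint.norm (Integrable.add (hconst _) (hint2.const_mul _)) fun t => ?_
    have : ε / (2 * c) + c / (2 * ε) * ‖h' t‖ ^ 2 - ‖h' t‖
        = (ε - c * ‖h' t‖) ^ 2 / (2 * ε * c) := by
      field_simp
      ring
    have : 0 ≤ (ε - c * ‖h' t‖) ^ 2 / (2 * ε * c) := by positivity
    simp only
    linarith
  rw [integral_add (hconst _) (hint2.const_mul _), integral_const_mul, setIntegral_const] at hle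
  have hvol : volume.real (Ioo a b) = b - a := by simp [Measure.real, hab]
  rw [hvol, smul_eq_mul] at hle
  have h1 : (b - a) * (ε / (2 * c)) ≤ c * (ε / (2 * c)) := by gcongr
  have h2 : c / (2 * ε) * ∫ t in Ioo a b, ‖h' t‖ ^ 2 < c / (2 * ε) * (ε ^ 2 / c) := by gcongr
  have h3 : c * (ε / (2 * c)) = ε / 2 := by field_simp
  have h4 : c / (2 * ε) * (ε ^ 2 / c) = ε / 2 := by field_simp
  have h5 := norm_integral_le_integral_norm (μ := volume.restrict (Ioo a b)) h'
  rw [hftc] at h5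
  linarith

/-- Every unit vector of the Euclidean plane is the image of `1` under an isometric identification
of `ℂ` with the plane. -/
theorem exists_complex_linearIsometryEquiv_map_one {p : EuclideanSpace ℝ (Fin 2)} (hp : ‖p‖ = 1) :
    ∃ L : ℂ ≃ₗᵢ[ℝ] EuclideanSpace ℝ (Fin 2), L 1 = p := by
  obtain ⟨u, rfl⟩ := Complex.orthonormalBasisOneI.repr.surjective p
  rw [LinearIsometryEquiv.norm_map] at hp
  obtain ⟨c, rfl⟩ : ∃ c : Circle, (c : ℂ) = u := ⟨⟨u, mem_sphere_zero_iff_norm.2 hp⟩, rfl⟩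
  refine ⟨(rotation c).trans Complex.orthonormalBasisOneI.repr, ?_⟩
  rw [LinearIsometryEquiv.trans_apply, rotation_apply, mul_one]

/-- Open circular arcs are connected. -/
theorem isPreconnected_sphere_inter_setOf_lt_inner {p : EuclideanSpace ℝ (Fin 2)} (hp : ‖p‖ = 1)
    (c : ℝ) :
    IsPreconnected (sphere (0 : EuclideanSpace ℝ (Fin 2)) 1 ∩ {x | c < inner ℝ p x}) := by
  obtain ⟨L, hL⟩ := exists_complex_linearIsometryEquiv_map_one hp
  have hinner : ∀ t : ℝ, inner ℝ p (L (Complex.exp (t * Complex.I))) = Real.cos t := by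
    intro t
    rw [← hL, L.inner_map_map, Complex.inner]
    simp [Complex.exp_ofReal_mul_I_re]
  refine isPreconnected_of_forall p fun x hx => ?_
  obtain ⟨w, rfl⟩ := L.surjective x
  have hw : ‖w‖ = 1 := by simpa using hx.1
  have hwexp : w = Complex.exp (w.arg * Complex.I) := by
    conv_lhs => rw [← Complex.norm_mul_exp_arg_mul_I w, hw]
    simp
  refine ⟨(fun t : ℝ => L (Complex.exp (t * Complex.I))) '' Icc (-|w.arg|) |w.arg|,
    ?_, ⟨0, by simp, by simp [hL]⟩, ⟨w.arg, ⟨neg_abs_le _, le_abs_self _⟩, ?_⟩, ?_⟩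
  · rintro _ ⟨t, ht, rfl⟩
    refine ⟨by simp [Complex.norm_exp_ofReal_mul_I], ?_⟩
    have h1 := hx.2
    rw [mem_ofPred_eq, hwexp, hinner] at h1
    rw [mem_ofPred_eq, hinner]
    refine h1.trans_le ?_
    rw [← Real.cos_abs t, ← Real.cos_abs w.arg]
    exact Real.cos_le_cos_of_nonneg_of_le_pi (abs_nonneg _) (Complex.abs_arg_le_pi w)
      (abs_le.2 ht)
  · exact congrArg L hwexp.symm
  · exact isPreconnected_Icc.image _ (by fun_prop)

/-- The squared norm of a directional derivative in the plane is at most the energy density times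
the squared length of the direction. -/
theorem norm_apply_sq_le_energy {F : Type*} [NormedAddCommGroup F] [NormedSpace ℝ F]
    (D : EuclideanSpace ℝ (Fin 2) →L[ℝ] F) (v : EuclideanSpace ℝ (Fin 2)) :
    ‖D v‖ ^ 2 ≤ ‖v‖ ^ 2 * (‖D (EuclideanSpace.single 0 1)‖ ^ 2 +
      ‖D (EuclideanSpace.single 1 1)‖ ^ 2) := by
  have hv : v = v 0 • EuclideanSpace.single 0 1 + v 1 • EuclideanSpace.single 1 1 := by
    ext i
    fin_cases i <;> simp
  have hn : ‖v‖ ^ 2 = |v 0| ^ 2 + |v 1| ^ 2 := by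
    simp [EuclideanSpace.norm_sq_eq, Fin.sum_univ_two]
  have hD : ‖D v‖ ≤ |v 0| * ‖D (EuclideanSpace.single 0 1)‖ +
      |v 1| * ‖D (EuclideanSpace.single 1 1)‖ := by
    conv_lhs => rw [hv, map_add, map_smul, map_smul]
    exact (norm_add_le _ _).trans_eq (by simp [norm_smul])
  rw [hn]
  calc ‖D v‖ ^ 2 ≤ (|v 0| * ‖D (EuclideanSpace.single 0 1)‖ +
      |v 1| * ‖D (EuclideanSpace.single 1 1)‖) ^ 2 := by gcongr
    _ ≤ _ := by
      nlinarith [sq_nonneg (|v 0| * ‖D (EuclideanSpace.single 1 1)‖ -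
        |v 1| * ‖D (EuclideanSpace.single 0 1)‖)]

/-- The Dirichlet energy density of a map defined on the Euclidean plane. -/
noncomputable def dirichletDensity {F : Type*} [NormedAddCommGroup F] [NormedSpace ℝ F]
    (X : EuclideanSpace ℝ (Fin 2) → F) (z : EuclideanSpace ℝ (Fin 2)) : ℝ :=
  ‖fderiv ℝ X z (EuclideanSpace.single 0 1)‖ ^ 2 + ‖fderiv ℝ X z (EuclideanSpace.single 1 1)‖ ^ 2

theorem measurable_dirichletDensity {F : Type*} [NormedAddCommGroup F] [NormedSpace ℝ F]
    [CompleteSpace F] (X : EuclideanSpace ℝ (Fin 2) → F) : Measurable (dirichletDensity X) := by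
  borelize F
  unfold dirichletDensity
  exact ((measurable_fderiv_apply_const ℝ X _).norm.pow_const 2).add
    ((measurable_fderiv_apply_const ℝ X _).norm.pow_const 2)

theorem norm_add_map_sq {p : EuclideanSpace ℝ (Fin 2)} {L : ℂ ≃ₗᵢ[ℝ] EuclideanSpace ℝ (Fin 2)}
    (hL : L 1 = -p) (w : ℂ) : ‖p + L w‖ ^ 2 = 1 - 2 * w.re + ‖w‖ ^ 2 := by
  have h : p + L w = L (w - 1) := by
    rw [map_sub, hL]
    abel
  rw [h, L.norm_map, Complex.sq_norm, Complex.sq_norm, Complex.normSq_apply, Complex.normSq_apply]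
  simp
  ring

theorem norm_add_map_mul_exp_sq {p : EuclideanSpace ℝ (Fin 2)}
    {L : ℂ ≃ₗᵢ[ℝ] EuclideanSpace ℝ (Fin 2)} (hL : L 1 = -p) (r θ : ℝ) :
    ‖p + L (r * Complex.exp (θ * Complex.I))‖ ^ 2 = 1 - 2 * (r * Real.cos θ) + r ^ 2 := by
  rw [norm_add_map_sq hL, Complex.re_ofReal_mul, Complex.exp_ofReal_mul_I_re, norm_mul,
    Complex.norm_exp_ofReal_mul_I]
  simp

/-- If the endpoints of the part in the unit disk of the circle of radius `r` around a boundary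
point have images at distance at least `ε`, the energy density on that arc is bounded below. -/
theorem ofReal_sq_div_pi_le_lintegral_arc {F : Type*} [NormedAddCommGroup F] [NormedSpace ℝ F]
    [CompleteSpace F] {X : EuclideanSpace ℝ (Fin 2) → F} (hXc : ContinuousOn X (closedBall 0 1))
    (hXd : ContDiffOn ℝ 1 X (ball 0 1)) {p : EuclideanSpace ℝ (Fin 2)}
    {L : ℂ ≃ₗᵢ[ℝ] EuclideanSpace ℝ (Fin 2)} (hL : L 1 = -p) {r ε : ℝ} (hr : 0 < r) (hr2 : r ≤ 2)
    (hε : 0 < ε)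
    (hend : ε ≤ ‖X (p + L (r * Complex.exp (Real.arccos (r / 2) * Complex.I))) -
      X (p + L (r * Complex.exp (-Real.arccos (r / 2) * Complex.I)))‖) :
    ENNReal.ofReal (ε ^ 2 / Real.pi) ≤
      ∫⁻ θ in Ioo (-Real.arccos (r / 2)) (Real.arccos (r / 2)), ENNReal.ofReal
        (r ^ 2 * dirichletDensity X (p + L (r * Complex.exp (θ * Complex.I)))) := by
  set c : ℝ → EuclideanSpace ℝ (Fin 2) := fun θ => p + L (r * Complex.exp (θ * Complex.I)) with hc
  set α := Real.arccos (r / 2) with hα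
  have hα0 : 0 ≤ α := Real.arccos_nonneg _
  have hαπ : α ≤ Real.pi := Real.arccos_le_pi _
  have hα2 : α ≤ Real.pi / 2 := Real.arccos_le_pi_div_two.2 (by positivity)
  have hcosα : Real.cos α = r / 2 := Real.cos_arccos (by linarith) (by linarith)
  have hccont : Continuous c := by fun_prop
  have hball : ∀ θ ∈ Ioo (-α) α, c θ ∈ ball 0 1 := by
    intro θ hθ
    have hlt : r / 2 < Real.cos θ := by
      rw [← hcosα, ← Real.cos_abs θ]
      exact Real.cos_lt_cos_of_nonneg_of_le_pi (abs_nonneg _) hαπ (abs_lt.2 hθ)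
    rw [mem_ball_zero_iff, ← sq_lt_one_iff₀ (norm_nonneg _), hc, norm_add_map_mul_exp_sq hL]
    nlinarith
  have hcball : ∀ θ ∈ Icc (-α) α, c θ ∈ closedBall 0 1 := by
    intro θ hθ
    have hlt : r / 2 ≤ Real.cos θ := by
      rw [← hcosα, ← Real.cos_abs θ]
      exact Real.cos_le_cos_of_nonneg_of_le_pi (abs_nonneg _) hαπ (abs_le.2 hθ)
    rw [mem_closedBall_zero_iff, ← sq_le_one_iff₀ (norm_nonneg _), hc, norm_add_map_mul_exp_sq hL]
    nlinarith
  have hcderiv : ∀ θ : ℝ, HasDerivAt c (L (r * (Complex.exp (θ * Complex.I) * Complex.I))) θ := by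
    intro θ
    have h1 : HasDerivAt (fun θ : ℝ => (r : ℂ) * Complex.exp (θ * Complex.I))
        (r * (Complex.exp (θ * Complex.I) * Complex.I)) θ := by
      have h0 : HasDerivAt (fun θ : ℝ => (θ : ℂ) * Complex.I) Complex.I θ := by
        simpa using (Complex.ofRealCLM.hasDerivAt (x := θ)).mul_const Complex.I
      exact h0.cexp.const_mul _
    exact ((L.toContinuousLinearEquiv.toContinuousLinearMap.hasFDerivAt).comp_hasDerivAt θ
      h1).const_add p
  have hXdiff : ∀ θ ∈ Ioo (-α) α, DifferentiableAt ℝ X (c θ) := fun θ hθ =>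
    (hXd.differentiableOn one_ne_zero).differentiableAt (isOpen_ball.mem_nhds (hball θ hθ))
  have key := ofReal_sq_div_le_lintegral_norm_deriv_sq (h := X ∘ c)
    (h' := fun θ => fderiv ℝ X (c θ) (L (r * (Complex.exp (θ * Complex.I) * Complex.I))))
    (a := -α) (b := α) (c := Real.pi) (ε := ε) (by linarith)
    (hXc.comp hccont.continuousOn hcball)
    (fun θ hθ => (hXdiff θ hθ).hasFDerivAt.comp_hasDerivAt θ (hcderiv θ))
    (((hXd.continuousOn_fderiv_of_isOpen isOpen_ball le_rfl).comp hccont.continuousOn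
      hball).clm_apply (by fun_prop)) Real.pi_pos (by linarith) hε
      (by simpa [hc] using hend)
  refine key.trans (lintegral_mono fun θ => ENNReal.ofReal_le_ofReal ?_)
  refine (norm_apply_sq_le_energy _ _).trans_eq ?_
  rw [L.norm_map, norm_mul, norm_mul, Complex.norm_exp_ofReal_mul_I]
  simp [dirichletDensity, hc]

/-- Polar coordinates around a point, restricted to an annulus. -/
theorem lintegral_annulus_le_lintegral {p : EuclideanSpace ℝ (Fin 2)}
    (L : ℂ ≃ₗᵢ[ℝ] EuclideanSpace ℝ (Fin 2)) {δ R : ℝ} (hδ : 0 ≤ δ)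
    {G : EuclideanSpace ℝ (Fin 2) → ENNReal} (hG : Measurable G) :
    ∫⁻ r in Ioo δ R, ∫⁻ θ in Ioo (-Real.pi) Real.pi,
      ENNReal.ofReal r * G (p + L (r * Complex.exp (θ * Complex.I))) ≤ ∫⁻ z, G z := by
  have hmp : MeasurePreserving (fun w : ℂ => p + L w) :=
    (measurePreserving_add_left volume p).comp L.measurePreserving
  have hmeas : Measurable (fun q : ℝ × ℝ =>
      ENNReal.ofReal q.1 * G (p + L (q.1 * Complex.exp (q.2 * Complex.I)))) := by
    refine (ENNReal.measurable_ofReal.comp measurable_fst).mul (hG.comp ?_)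
    exact Continuous.measurable (by fun_prop)
  rw [← hmp.lintegral_comp hG, ← Complex.lintegral_comp_polarCoord_symm,
    ← setLIntegral_prod _ hmeas.aemeasurable, ← Measure.volume_eq_prod]
  refine (lintegral_mono_set (prod_mono (fun r hr => ?_) subset_rfl)).trans_eq
    (lintegral_congr fun q => ?_)
  · exact hδ.trans_lt hr.1
  · rw [Complex.polarCoord_symm_apply, smul_eq_mul, Complex.exp_mul_I, Complex.ofReal_cos,
      Complex.ofReal_sin]

theorem setLIntegral_ofReal_mul_inv {δ R k : ℝ} (hδ : 0 < δ) (hδR : δ ≤ R) (hk : 0 ≤ k) :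
    ∫⁻ r in Ioo δ R, ENNReal.ofReal (k * r⁻¹) = ENNReal.ofReal (k * Real.log (R / δ)) := by
  have hint : IntervalIntegrable (fun r : ℝ => k * r⁻¹) volume δ R :=
    (intervalIntegral.intervalIntegrable_inv (fun r hr => by
      rw [uIcc_of_le hδR] at hr
      exact (hδ.trans_le hr.1).ne') continuousOn_id).const_mul k
  rw [← ofReal_integral_eq_lintegral_ofReal
    ((intervalIntegrable_iff_integrableOn_Ioo_of_le hδR).1 hint)
    ((ae_restrict_iff' measurableSet_Ioo).2 (ae_of_all _ fun r hr => by
      have := hδ.trans hr.1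
      simp only [Pi.zero_apply]
      positivity)), ← integral_Ioc_eq_integral_Ioo, ← intervalIntegral.integral_of_le hδR,
    intervalIntegral.integral_const_mul, integral_inv_of_pos hδ (hδ.trans_le hδR)]

/-- **Courant–Lebesgue lemma**: some circle around a boundary point, with radius in a prescribed
interval, meets the unit circle in two points with close images. -/
theorem exists_radius_norm_sub_lt {F : Type*} [NormedAddCommGroup F] [NormedSpace ℝ F]
    [CompleteSpace F] {X : EuclideanSpace ℝ (Fin 2) → F} (hXc : ContinuousOn X (closedBall 0 1))
    (hXd : ContDiffOn ℝ 1 X (ball 0 1)) {p : EuclideanSpace ℝ (Fin 2)} (hp : ‖p‖ = 1)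
    {δ R ε : ℝ} (hδ : 0 < δ) (hδR : δ ≤ R) (hR : R ≤ 2) (hε : 0 < ε)
    (hE : ∫⁻ z in ball (0 : EuclideanSpace ℝ (Fin 2)) 1, ENNReal.ofReal (dirichletDensity X z) <
      ENNReal.ofReal (ε ^ 2 / Real.pi * Real.log (R / δ))) :
    ∃ r ∈ Ioo δ R, ∃ a ∈ sphere (0 : EuclideanSpace ℝ (Fin 2)) 1,
      ∃ b ∈ sphere (0 : EuclideanSpace ℝ (Fin 2)) 1, dist a p = r ∧ dist b p = r ∧ a ≠ b ∧
        (∀ x ∈ sphere (0 : EuclideanSpace ℝ (Fin 2)) 1, dist x p = r → x = a ∨ x = b) ∧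
        ‖X a - X b‖ < ε := by
  obtain ⟨L, hL⟩ := exists_complex_linearIsometryEquiv_map_one (p := -p) (by rwa [norm_neg])
  have hcos : ∀ r ∈ Ioo δ R, Real.cos (Real.arccos (r / 2)) = r / 2 := fun r hr =>
    Real.cos_arccos (by linarith [hr.1]) (by linarith [hr.2])
  have hmem : ∀ r ∈ Ioo δ R, ∀ θ : ℝ, Real.cos θ = r / 2 →
      p + L (r * Complex.exp (θ * Complex.I)) ∈ sphere (0 : EuclideanSpace ℝ (Fin 2)) 1 := by
    intro r hr θ hθ
    rw [mem_sphere_zero_iff_norm, ← pow_eq_one_iff_of_nonneg (norm_nonneg _) two_ne_zero,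
      norm_add_map_mul_exp_sq hL, hθ]
    ring
  have hdist : ∀ r ∈ Ioo δ R, ∀ θ : ℝ, dist (p + L (r * Complex.exp (θ * Complex.I))) p = r := by
    intro r hr θ
    rw [dist_eq_norm, add_sub_cancel_left, L.norm_map, norm_mul, Complex.norm_exp_ofReal_mul_I]
    simp [(hδ.trans hr.1).le]
  by_contra! hcon
  refine hE.not_ge ?_
  set α : ℝ → ℝ := fun r => Real.arccos (r / 2) with hα
  have hfar : ∀ r ∈ Ioo δ R, ε ≤ ‖X (p + L (r * Complex.exp (α r * Complex.I))) -
      X (p + L (r * Complex.exp (-α r * Complex.I)))‖ := by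
    intro r hr
    have hneg := hcon r hr _ (hmem r hr (α r) (hcos r hr)) _
      (hmem r hr (-α r) ((Real.cos_neg _).trans (hcos r hr))) (hdist r hr _) (hdist r hr _)
    rw [Complex.ofReal_neg] at hneg
    have hne : p + L (r * Complex.exp (α r * Complex.I)) ≠
        p + L (r * Complex.exp (-α r * Complex.I)) := by
      intro h
      have h1 := congrArg Complex.im (L.injective (add_left_cancel h))
      rw [← Complex.ofReal_neg, Complex.im_ofReal_mul, Complex.im_ofReal_mul,
        Complex.exp_ofReal_mul_I_im, Complex.exp_ofReal_mul_I_im, Real.sin_neg] at h1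
      have hα0 : 0 < α r := Real.arccos_pos.2 (by linarith [hr.2])
      have hα2 : α r ≤ Real.pi / 2 :=
        Real.arccos_le_pi_div_two.2 (by linarith [hr.1])
      have hsin := Real.sin_pos_of_pos_of_lt_pi hα0 (by linarith [Real.pi_pos])
      have := mul_pos (hδ.trans hr.1) hsin
      linarith
    refine hneg hne fun x hx hxr => ?_
    obtain ⟨w, hw⟩ := L.surjective (x - p)
    have hxw : x = p + L w := by rw [hw]; abel
    have hwr : ‖w‖ = r := by rw [← hxr, dist_eq_norm, ← hw, L.norm_map]
    have hwre : w.re = r * Real.cos (α r) := by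
      have h1 := norm_add_map_sq hL w
      rw [← hxw, mem_sphere_zero_iff_norm.1 hx, hwr] at h1
      rw [hα, hcos r hr]
      linarith
    have hwim : w.im ^ 2 = (r * Real.sin (α r)) ^ 2 := by
      have h1 := Complex.sq_norm w
      rw [Complex.normSq_apply, hwr, hwre] at h1
      linear_combination -h1 - r ^ 2 * Real.sin_sq_add_cos_sq (α r)
    rw [hxw]
    rcases sq_eq_sq_iff_eq_or_eq_neg.1 hwim with h | h
    · left
      congr 2
      apply Complex.ext
      · rw [hwre, Complex.re_ofReal_mul, Complex.exp_ofReal_mul_I_re]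
      · rw [h, Complex.im_ofReal_mul, Complex.exp_ofReal_mul_I_im]
    · right
      congr 2
      rw [← Complex.ofReal_neg]
      apply Complex.ext
      · rw [hwre, Complex.re_ofReal_mul, Complex.exp_ofReal_mul_I_re, Real.cos_neg]
      · rw [h, Complex.im_ofReal_mul, Complex.exp_ofReal_mul_I_im, Real.sin_neg, mul_neg]
  set G : EuclideanSpace ℝ (Fin 2) → ENNReal :=
    (ball 0 1).indicator fun z => ENNReal.ofReal (dirichletDensity X z) with hG
  have hGm : Measurable G :=
    (measurable_dirichletDensity X).ennreal_ofReal.indicator measurableSet_ball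
  rw [← lintegral_indicator measurableSet_ball, ← setLIntegral_ofReal_mul_inv hδ hδR
    (by positivity)]
  refine le_trans ?_ (lintegral_annulus_le_lintegral (p := p) L (R := R) hδ.le hGm)
  refine setLIntegral_mono' measurableSet_Ioo fun r hr => ?_
  have hr0 : 0 < r := hδ.trans hr.1
  have harc := ofReal_sq_div_pi_le_lintegral_arc hXc hXd hL hr0 (hr.2.le.trans hR) hε (hfar r hr)
  have hαπ : α r ≤ Real.pi := Real.arccos_le_pi _
  rw [mul_comm, ENNReal.ofReal_mul (by positivity)]
  calc ENNReal.ofReal r⁻¹ * ENNReal.ofReal (ε ^ 2 / Real.pi)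
      ≤ ENNReal.ofReal r⁻¹ * ∫⁻ θ in Ioo (-α r) (α r), ENNReal.ofReal
        (r ^ 2 * dirichletDensity X (p + L (r * Complex.exp (θ * Complex.I)))) := by gcongr
    _ = ∫⁻ θ in Ioo (-α r) (α r), ENNReal.ofReal r⁻¹ * ENNReal.ofReal
        (r ^ 2 * dirichletDensity X (p + L (r * Complex.exp (θ * Complex.I)))) :=
      (lintegral_const_mul' _ _ ENNReal.ofReal_ne_top).symm
    _ ≤ ∫⁻ θ in Ioo (-α r) (α r),
        ENNReal.ofReal r * G (p + L (r * Complex.exp (θ * Complex.I))) := by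
      refine setLIntegral_mono' measurableSet_Ioo fun θ hθ => ?_
      have hlt : r / 2 < Real.cos θ := by
        rw [← hcos r hr, ← Real.cos_abs θ]
        exact Real.cos_lt_cos_of_nonneg_of_le_pi (abs_nonneg _) hαπ (abs_lt.2 hθ)
      have hin : p + L (r * Complex.exp (θ * Complex.I)) ∈ ball 0 1 := by
        rw [mem_ball_zero_iff, ← sq_lt_one_iff₀ (norm_nonneg _), norm_add_map_mul_exp_sq hL]
        nlinarith
      rw [hG, indicator_of_mem hin, ← ENNReal.ofReal_mul (by positivity),
        ← ENNReal.ofReal_mul hr0.le, ← mul_assoc]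
      refine le_of_eq (congrArg _ (congrArg (· * _) ?_))
      field_simp
    _ ≤ _ := lintegral_mono_set (Ioo_subset_Ioo (neg_le_neg hαπ) hαπ)

/-- A component of the unit circle minus its two points at distance `r` from a point `p` of the
circle is one of the two arcs determined by them. -/
theorem subset_connectedComponentIn_sphere {p a b z : EuclideanSpace ℝ (Fin 2)} {r : ℝ}
    (hp : ‖p‖ = 1) (hr : 0 ≤ r) (ha : dist a p = r) (hb : dist b p = r)
    (hab : ∀ x ∈ sphere (0 : EuclideanSpace ℝ (Fin 2)) 1, dist x p = r → x = a ∨ x = b)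
    (hz : z ∈ sphere (0 : EuclideanSpace ℝ (Fin 2)) 1 \ {a, b}) :
    sphere 0 1 ∩ ball p r ⊆ connectedComponentIn (sphere 0 1 \ {a, b}) z ∨
      sphere 0 1 \ closedBall p r ⊆ connectedComponentIn (sphere 0 1 \ {a, b}) z := by
  have hin : ∀ x ∈ sphere (0 : EuclideanSpace ℝ (Fin 2)) 1,
      dist x p ^ 2 = 2 - 2 * inner ℝ p x := by
    intro x hx
    rw [dist_eq_norm, norm_sub_sq_real, mem_sphere_zero_iff_norm.1 hx, hp, real_inner_comm]
    ring
  rcases lt_trichotomy (dist z p) r with h | h | h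
  · left
    refine IsPreconnected.subset_connectedComponentIn ?_ ⟨hz.1, h⟩ ?_
    · convert isPreconnected_sphere_inter_setOf_lt_inner hp (1 - r ^ 2 / 2) using 1
      ext x
      refine and_congr_right fun hx => ?_
      rw [mem_ball, mem_ofPred_eq, ← sq_lt_sq₀ dist_nonneg hr, hin x hx]
      constructor <;> intro h <;> linarith
    · rintro x ⟨hx, hxr⟩
      refine ⟨hx, ?_⟩
      rintro (rfl | rfl)
      · exact hxr.ne ha
      · exact hxr.ne hb
  · exact absurd (hab z hz.1 h) hz.2
  · right
    refine IsPreconnected.subset_connectedComponentIn ?_ ⟨hz.1, by simpa using h⟩ ?_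
    · convert isPreconnected_sphere_inter_setOf_lt_inner (p := -p) (by rwa [norm_neg])
        (r ^ 2 / 2 - 1) using 1
      ext x
      refine and_congr_right fun hx => ?_
      rw [mem_closedBall, not_le, mem_ofPred_eq, ← sq_lt_sq₀ hr dist_nonneg, hin x hx,
        inner_neg_left]
      constructor <;> intro h <;> linarith
    · rintro x ⟨hx, hxr⟩
      refine ⟨hx, ?_⟩
      rintro (rfl | rfl)
      · exact hxr ha.le
      · exact hxr hb.le

/-- **Equicontinuity of Jordan curves with uniformly bounded Dirichlet energy**
(Theorem `comp` of the paper, Euclidean-target version). `S` is the unit circle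
`S¹ ⊆ ℝ²`, `γₙ : S¹ → ℝ^{m₁}` are Jordan curves, `fₙ : S¹ → ℝ^{m₂}` continuous,
and `gₙ = (γₙ, fₙ)`. Hypotheses: (1) the mutual distances of the images of three
fixed distinct points of `S¹` are bounded below by `I > 0`; (2) a three-point
condition: whenever `gₙ(ζ)` and `gₙ(ζ')` are `ε`-close, one of the two closed arcs
of `S¹` with endpoints `ζ, ζ'` (a connected component of `S¹ \ {ζ,ζ'}` together with
the endpoints) has `γₙ`-image of diameter `< μ`; (3) the `gₙ` extend to maps `Xₙ` of
the closed unit disk, `C¹` on the open disk, with Dirichlet energy `< M`.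
Conclusion: the family `{γₙ}` is equicontinuous. -/
theorem stmt_0 (m₁ m₂ : ℕ)
    (S : Set (EuclideanSpace ℝ (Fin 2)))
    (hS : S = Metric.sphere (0 : EuclideanSpace ℝ (Fin 2)) 1)
    (ζ₁ ζ₂ ζ₃ : EuclideanSpace ℝ (Fin 2))
    (hζ₁ : ζ₁ ∈ S) (hζ₂ : ζ₂ ∈ S) (hζ₃ : ζ₃ ∈ S)
    (hne12 : ζ₁ ≠ ζ₂) (hne13 : ζ₁ ≠ ζ₃) (hne23 : ζ₂ ≠ ζ₃)
    (γ : ℕ → EuclideanSpace ℝ (Fin 2) → EuclideanSpace ℝ (Fin m₁))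
    (hγcont : ∀ n, ContinuousOn (γ n) S)
    (hγinj : ∀ n, Set.InjOn (γ n) S)
    (f : ℕ → EuclideanSpace ℝ (Fin 2) → EuclideanSpace ℝ (Fin m₂))
    (hfcont : ∀ n, ContinuousOn (f n) S)
    (g : ℕ → EuclideanSpace ℝ (Fin 2) → EuclideanSpace ℝ (Fin (m₁ + m₂)))
    (hg : ∀ n ζ (i : Fin (m₁ + m₂)),
      g n ζ i = Fin.append (fun j => γ n ζ j) (fun j => f n ζ j) i)
    -- (1) uniform lower bound on the mutual distances of the three marked points
    (I : ℝ) (hIpos : 0 < I)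
    (hI : ∀ n, I ≤ ‖γ n ζ₁ - γ n ζ₂‖ ∧ I ≤ ‖γ n ζ₁ - γ n ζ₃‖ ∧
      I ≤ ‖γ n ζ₂ - γ n ζ₃‖)
    -- (2) the three-point condition on the arcs of the circle
    (h2 : ∀ μ : ℝ, 0 < μ → ∃ ε : ℝ, 0 < ε ∧ ∀ n, ∀ ζ ∈ S, ∀ ζ' ∈ S,
      ‖g n ζ - g n ζ'‖ < ε →
        ζ = ζ' ∨ ∃ z ∈ S \ {ζ, ζ'},
          Metric.diam
            (γ n '' (connectedComponentIn (S \ {ζ, ζ'}) z ∪ {ζ, ζ'})) < μ)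
    -- (3) uniformly bounded Dirichlet energy of extensions to the disk
    (M : ℝ) (hMpos : 0 < M)
    (X : ℕ → EuclideanSpace ℝ (Fin 2) → EuclideanSpace ℝ (Fin (m₁ + m₂)))
    (hXcont : ∀ n, ContinuousOn (X n) (Metric.closedBall 0 1))
    (hXdiff : ∀ n, ContDiffOn ℝ 1 (X n) (Metric.ball 0 1))
    (hXbd : ∀ n, ∀ ζ ∈ S, X n ζ = g n ζ)
    (hE : ∀ n,
      (∫⁻ z in Metric.ball (0 : EuclideanSpace ℝ (Fin 2)) 1,
        ENNReal.ofReal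
          (‖fderiv ℝ (X n) z (EuclideanSpace.single 0 1)‖ ^ 2 +
            ‖fderiv ℝ (X n) z (EuclideanSpace.single 1 1)‖ ^ 2)) <
        ENNReal.ofReal M) :
    ∀ e : ℝ, 0 < e → ∃ δ : ℝ, 0 < δ ∧ ∀ n, ∀ ζ ∈ S, ∀ ζ' ∈ S,
      ‖ζ - ζ'‖ < δ → ‖γ n ζ - γ n ζ'‖ < e := by
  subst hS
  intro e he
  obtain ⟨ε, hε, h2⟩ := h2 (min e I) (lt_min he hIpos)
  obtain ⟨R, hR0, hR1, hR12, hR13, hR23⟩ : ∃ R : ℝ, 0 < R ∧ R ≤ 1 ∧ 2 * R ≤ dist ζ₁ ζ₂ ∧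
      2 * R ≤ dist ζ₁ ζ₃ ∧ 2 * R ≤ dist ζ₂ ζ₃ := by
    have h12 := dist_pos.2 hne12
    have h13 := dist_pos.2 hne13
    have h23 := dist_pos.2 hne23
    have hm : 0 < min (min 2 (dist ζ₁ ζ₂)) (min (dist ζ₁ ζ₃) (dist ζ₂ ζ₃)) := by positivity
    refine ⟨min (min 2 (dist ζ₁ ζ₂)) (min (dist ζ₁ ζ₃) (dist ζ₂ ζ₃)) / 2, by positivity, ?_⟩
    have hl := min_le_left (min 2 (dist ζ₁ ζ₂)) (min (dist ζ₁ ζ₃) (dist ζ₂ ζ₃))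
    have hr := min_le_right (min 2 (dist ζ₁ ζ₂)) (min (dist ζ₁ ζ₃) (dist ζ₂ ζ₃))
    rw [le_min_iff] at hl hr
    refine ⟨?_, ?_, ?_, ?_⟩ <;> linarith [hl.1, hl.2, hr.1, hr.2]
  set k : ℝ := Real.pi * M / ε ^ 2 with hk
  have hk0 : 0 < k := by positivity
  refine ⟨R * Real.exp (-k), by positivity, fun n p hp q hq hpq => ?_⟩
  have hpn : ‖p‖ = 1 := mem_sphere_zero_iff_norm.1 hp
  have hδR : R * Real.exp (-k) ≤ R :=
    mul_le_of_le_one_right hR0.le (Real.exp_le_one_iff.2 (by linarith))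
  have hlog : ε ^ 2 / Real.pi * Real.log (R / (R * Real.exp (-k))) = M := by
    rw [Real.exp_neg, show R / (R * (Real.exp k)⁻¹) = Real.exp k by field_simp, Real.log_exp, hk]
    field_simp
  obtain ⟨r, hr, a, ha, b, hb, har, hbr, hne, hab, hlt⟩ := exists_radius_norm_sub_lt (hXcont n)
    (hXdiff n) hpn (by positivity) hδR (hR1.trans one_le_two) hε (by rw [hlog]; exact hE n)
  have hr0 : 0 < r := lt_trans (by positivity) hr.1
  rw [hXbd n a ha, hXbd n b hb] at hlt
  have hbdd : Bornology.IsBounded (γ n '' sphere 0 1) :=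
    ((isCompact_sphere _ _).image_of_continuousOn (hγcont n)).isBounded
  rcases h2 n a ha b hb hlt with h | ⟨z, hz, hdiam⟩
  · exact absurd h hne
  have hsub : connectedComponentIn (sphere 0 1 \ {a, b}) z ∪ {a, b} ⊆
      sphere (0 : EuclideanSpace ℝ (Fin 2)) 1 :=
    union_subset ((connectedComponentIn_subset _ _).trans sdiff_subset)
      (insert_subset ha (singleton_subset_iff.2 hb))
  have hclose : ∀ x ∈ connectedComponentIn (sphere 0 1 \ {a, b}) z ∪ {a, b},
      ∀ y ∈ connectedComponentIn (sphere 0 1 \ {a, b}) z ∪ {a, b},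
      ‖γ n x - γ n y‖ < min e I := by
    intro x hx y hy
    rw [← dist_eq_norm]
    exact (dist_le_diam_of_mem (hbdd.subset (image_mono hsub)) (mem_image_of_mem _ hx)
      (mem_image_of_mem _ hy)).trans_lt hdiam
  rcases subset_connectedComponentIn_sphere hpn hr0.le har hbr hab hz with hC | hC
  · refine (hclose p (.inl (hC ⟨hp, mem_ball_self hr0⟩)) q (.inl (hC ⟨hq, ?_⟩))).trans_le
      (min_le_left _ _)
    rw [mem_ball, dist_comm, dist_eq_norm]
    exact hpq.trans hr.1
  · exfalso
    have hout : ∀ x ∈ sphere (0 : EuclideanSpace ℝ (Fin 2)) 1, r ≤ dist x p →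
        x ∈ connectedComponentIn (sphere 0 1 \ {a, b}) z ∪ {a, b} := by
      intro x hx hxr
      rcases hxr.eq_or_lt with h | h
      · exact .inr (hab x hx h.symm)
      · exact .inl (hC ⟨hx, by simpa using h⟩)
    have hfar : ∀ x ∈ sphere (0 : EuclideanSpace ℝ (Fin 2)) 1,
        ∀ y ∈ sphere (0 : EuclideanSpace ℝ (Fin 2)) 1, I ≤ ‖γ n x - γ n y‖ →
        dist x p < r ∨ dist y p < r := by
      intro x hx y hy hxy
      by_contra! h
      exact ((hclose x (hout x hx h.1) y (hout y hy h.2)).trans_le (min_le_right _ _)).not_ge hxy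
    have hnear : ∀ x y, 2 * R ≤ dist x y → dist x p < r → dist y p < r → False := by
      intro x y hxy hx hy
      linarith [dist_triangle_right x y p, hr.2]
    obtain ⟨h12, h13, h23⟩ := hI n
    rcases hfar ζ₁ hζ₁ ζ₂ hζ₂ h12 with h | h
    · rcases hfar ζ₂ hζ₂ ζ₃ hζ₃ h23 with h' | h'
      · exact hnear _ _ hR12 h h'
      · exact hnear _ _ hR13 h h'
    · rcases hfar ζ₁ hζ₁ ζ₃ hζ₃ h13 with h' | h'
      · exact hnear _ _ hR12 h' h
      · exact hnear _ _ hR23 h h'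
end

section
/- Gradient estimate for solutions of the minimal surface equation on a half-strip with opposite infinite boundary values: Let a > 0 and let u be a solution of the minimal surface equation on the open half-strip S = (0,a) × (0,∞) such that for every y₀ > 0, u(x,y) tends to −∞ as (x,y) ∈ S tends to (0,y₀), and u(x,y) tends to +∞ as (x,y) ∈ S tends to (a,y₀). Then for every (x,y) ∈ S with y ≥ 4a one has (|p|/W)(x,y) ≥ 1 − a²/y² and (|q|/W)(x,y) ≤ √2 · a/y. -/
open Real Filter Set

/-- First partial derivative (in the `x` direction) of a function on `ℝ × ℝ`. -/
noncomputable def pd1 (u : ℝ × ℝ → ℝ) (z : ℝ × ℝ) : ℝ := fderiv ℝ u z (1, 0)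

/-- Second partial derivative (in the `y` direction) of a function on `ℝ × ℝ`. -/
noncomputable def pd2 (u : ℝ × ℝ → ℝ) (z : ℝ × ℝ) : ℝ := fderiv ℝ u z (0, 1)

/-- `W = √(1 + p² + q²)` associated to a function `u` on `ℝ × ℝ`. -/
noncomputable def Wf (u : ℝ × ℝ → ℝ) (z : ℝ × ℝ) : ℝ :=
  Real.sqrt (1 + pd1 u z ^ 2 + pd2 u z ^ 2)

/-- `u` is a solution of the minimal surface equation on the open set `U`:
`u` is `C²` on `U` and `(1+q²)u_xx − 2pq·u_xy + (1+p²)u_yy = 0` on `U`. -/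
def IsMSESolution (U : Set (ℝ × ℝ)) (u : ℝ × ℝ → ℝ) : Prop :=
  ContDiffOn ℝ 2 u U ∧ ∀ z ∈ U,
    (1 + pd2 u z ^ 2) * pd1 (pd1 u) z
      - 2 * pd1 u z * pd2 u z * pd2 (pd1 u) z
      + (1 + pd1 u z ^ 2) * pd2 (pd2 u) z = 0

/-- A closed `1`-form `f dx + g dy` on an open convex set has a primitive. -/
theorem exists_primitive_of_closed {S : Set (ℝ × ℝ)} (hS : IsOpen S) (hc : Convex ℝ S)
    {f g : ℝ × ℝ → ℝ} (hf : DifferentiableOn ℝ f S) (hg : DifferentiableOn ℝ g S)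
    (h : ∀ z ∈ S, fderiv ℝ f z (0, 1) = fderiv ℝ g z (1, 0)) :
    ∃ F : ℝ × ℝ → ℝ, ∀ z ∈ S, HasFDerivAt F
      (f z • ContinuousLinearMap.fst ℝ ℝ ℝ + g z • ContinuousLinearMap.snd ℝ ℝ ℝ) z := by
  have key : ∀ z ∈ S, HasFDerivAt
      (fun z => f z • ContinuousLinearMap.fst ℝ ℝ ℝ + g z • ContinuousLinearMap.snd ℝ ℝ ℝ)
      ((fderiv ℝ f z).smulRight (ContinuousLinearMap.fst ℝ ℝ ℝ) +
        (fderiv ℝ g z).smulRight (ContinuousLinearMap.snd ℝ ℝ ℝ)) z := fun z hz =>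
    ((hf.differentiableAt (hS.mem_nhds hz)).hasFDerivAt.smul_const (_ : ℝ × ℝ →L[ℝ] ℝ)).add
      ((hg.differentiableAt (hS.mem_nhds hz)).hasFDerivAt.smul_const (_ : ℝ × ℝ →L[ℝ] ℝ))
  refine hc.exists_forall_hasFDerivAt_of_fderiv_symmetric hS
    (fun z hz => (key z hz).differentiableAt.differentiableWithinAt) ?_
  intro z hz v w
  rw [(key z hz).fderiv]
  have e : ∀ (T : ℝ × ℝ →L[ℝ] ℝ) (v : ℝ × ℝ), T v = v.1 * T (1, 0) + v.2 * T (0, 1) := by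
    intro T v
    have : v = v.1 • ((1 : ℝ), (0 : ℝ)) + v.2 • ((0 : ℝ), (1 : ℝ)) := by ext <;> simp
    conv_lhs => rw [this]
    simp only [map_add, map_smul, smul_eq_mul]
  have := h z hz
  simp only [add_apply, ContinuousLinearMap.smulRight_apply,
    smul_apply, ContinuousLinearMap.coe_fst', ContinuousLinearMap.coe_snd',
    smul_eq_mul]
  rw [e (fderiv ℝ f z) v, e (fderiv ℝ f z) w, e (fderiv ℝ g z) v, e (fderiv ℝ g z) w, this]
  ring

theorem Wf_pos (u : ℝ × ℝ → ℝ) (z : ℝ × ℝ) : 0 < Wf u z := by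
  unfold Wf; positivity

theorem Wf_sq (u : ℝ × ℝ → ℝ) (z : ℝ × ℝ) : Wf u z ^ 2 = 1 + pd1 u z ^ 2 + pd2 u z ^ 2 :=
  Real.sq_sqrt (by positivity)

theorem contDiffOn_fderiv_apply {S : Set (ℝ × ℝ)} (hS : IsOpen S) {u : ℝ × ℝ → ℝ}
    (hu : ContDiffOn ℝ 2 u S) (v : ℝ × ℝ) : ContDiffOn ℝ 1 (fun z => fderiv ℝ u z v) S :=
  (hu.fderiv_of_isOpen (m := 1) hS (by norm_num)).clm_apply contDiffOn_const

theorem pd1_pd2_comm {S : Set (ℝ × ℝ)} (hS : IsOpen S) {u : ℝ × ℝ → ℝ}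
    (hu : ContDiffOn ℝ 2 u S) {z : ℝ × ℝ} (hz : z ∈ S) : pd1 (pd2 u) z = pd2 (pd1 u) z := by
  have hd : DifferentiableAt ℝ (fderiv ℝ u) z :=
    ((hu.fderiv_of_isOpen (m := 1) hS (by norm_num)).differentiableOn
      (by norm_num)).differentiableAt (hS.mem_nhds hz)
  have hsym : IsSymmSndFDerivAt ℝ u z :=
    (hu.contDiffAt (hS.mem_nhds hz)).isSymmSndFDerivAt (by simp)
  have e : ∀ v w : ℝ × ℝ, fderiv ℝ (fun z => fderiv ℝ u z v) z w = fderiv ℝ (fderiv ℝ u) z w v := by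
    intro v w
    rw [(hd.hasFDerivAt.clm_apply (hasFDerivAt_const v z)).fderiv]
    simp
  exact (e _ _).trans ((hsym _ _).trans (e _ _).symm)

/-- A solution of the minimal surface equation provides primitives of the forms
`((1+p²)dx + pq dy)/W` and `(pq dx + (1+q²)dy)/W`. -/
theorem IsMSESolution.exists_primitives {S : Set (ℝ × ℝ)} (hS : IsOpen S) (hc : Convex ℝ S)
    {u : ℝ × ℝ → ℝ} (hu : IsMSESolution S u) :
    (∃ F : ℝ × ℝ → ℝ, ∀ z ∈ S, HasFDerivAt F
      (((1 + pd1 u z ^ 2) / Wf u z) • ContinuousLinearMap.fst ℝ ℝ ℝ +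
        (pd1 u z * pd2 u z / Wf u z) • ContinuousLinearMap.snd ℝ ℝ ℝ) z) ∧
    ∃ G : ℝ × ℝ → ℝ, ∀ z ∈ S, HasFDerivAt G
      ((pd1 u z * pd2 u z / Wf u z) • ContinuousLinearMap.fst ℝ ℝ ℝ +
        ((1 + pd2 u z ^ 2) / Wf u z) • ContinuousLinearMap.snd ℝ ℝ ℝ) z := by
  obtain ⟨hu2, hmse⟩ := hu
  have hp : ∀ z ∈ S, HasFDerivAt (pd1 u) (fderiv ℝ (pd1 u) z) z := fun z hz =>
    (((contDiffOn_fderiv_apply hS hu2 (1, 0)).differentiableOn (by norm_num)).differentiableAt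
      (hS.mem_nhds hz)).hasFDerivAt
  have hq : ∀ z ∈ S, HasFDerivAt (pd2 u) (fderiv ℝ (pd2 u) z) z := fun z hz =>
    (((contDiffOn_fderiv_apply hS hu2 (0, 1)).differentiableOn (by norm_num)).differentiableAt
      (hS.mem_nhds hz)).hasFDerivAt
  have hW : ∀ z ∈ S, HasFDerivAt (Wf u)
      ((1 / (2 * Wf u z)) • ((2 * pd1 u z) • fderiv ℝ (pd1 u) z +
        (2 * pd2 u z) • fderiv ℝ (pd2 u) z)) z := fun z hz => by
    have h1 := ((((hp z hz).pow 2).const_add 1).add ((hq z hz).pow 2)).sqrt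
      (show (0 : ℝ) < 1 + pd1 u z ^ 2 + pd2 u z ^ 2 by positivity).ne'
    refine h1.congr_fderiv ?_
    simp [Wf]
  have hWn : ∀ z, Wf u z ≠ 0 := fun z => (Wf_pos u z).ne'
  have hI := fun z hz => (hasDerivAt_inv (hWn z)).comp_hasFDerivAt z (hW z hz)
  have h1 := fun z hz => (((hp z hz).pow 2).const_add 1).fun_mul (hI z hz)
  have h2 := fun z hz => ((hp z hz).fun_mul (hq z hz)).fun_mul (hI z hz)
  have h3 := fun z hz => (((hq z hz).pow 2).const_add 1).fun_mul (hI z hz)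
  simp only [Function.comp_apply] at h1 h2 h3
  have key : ∀ z ∈ S,
      fderiv ℝ (fun z => (1 + pd1 u z ^ 2) * (Wf u z)⁻¹) z (0, 1) =
        fderiv ℝ (fun z => pd1 u z * pd2 u z * (Wf u z)⁻¹) z (1, 0) ∧
      fderiv ℝ (fun z => pd1 u z * pd2 u z * (Wf u z)⁻¹) z (0, 1) =
        fderiv ℝ (fun z => (1 + pd2 u z ^ 2) * (Wf u z)⁻¹) z (1, 0) := by
    intro z hz
    have e := hmse z hz
    have c : fderiv ℝ (pd2 u) z (1, 0) = fderiv ℝ (pd1 u) z (0, 1) := pd1_pd2_comm hS hu2 hz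
    rw [(h1 z hz).fderiv, (h2 z hz).fderiv, (h3 z hz).fderiv]
    have w := Wf_sq u z
    have w0 := hWn z
    unfold pd1 pd2 at e
    change (1 + pd2 u z ^ 2) * fderiv ℝ (pd1 u) z (1, 0)
      - 2 * pd1 u z * pd2 u z * fderiv ℝ (pd1 u) z (0, 1)
      + (1 + pd1 u z ^ 2) * fderiv ℝ (pd2 u) z (0, 1) = 0 at e
    simp only [add_apply, smul_apply, smul_eq_mul, nsmul_eq_mul, c]
    generalize pd1 u z = p at *
    generalize pd2 u z = q at *
    generalize Wf u z = W at *
    generalize fderiv ℝ (pd1 u) z (1, 0) = r at *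
    generalize fderiv ℝ (pd1 u) z (0, 1) = s at *
    generalize fderiv ℝ (pd2 u) z (0, 1) = t at *
    constructor
    · field_simp
      norm_num
      linear_combination (-q) * e + (p * s - q * r) * w
    · field_simp
      norm_num
      linear_combination p * e + (p * t - q * s) * w
  simp only [div_eq_mul_inv]
  exact ⟨exists_primitive_of_closed hS hc
      (fun z hz => (h1 z hz).differentiableAt.differentiableWithinAt)
      (fun z hz => (h2 z hz).differentiableAt.differentiableWithinAt) fun z hz => (key z hz).1,
    exists_primitive_of_closed hS hc
      (fun z hz => (h2 z hz).differentiableAt.differentiableWithinAt)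
      (fun z hz => (h3 z hz).differentiableAt.differentiableWithinAt) fun z hz => (key z hz).2⟩

/-- Gradient form of Harnack's inequality: a holomorphic function with positive real part on a
disc of radius `R` satisfies `‖g'(c)‖ ≤ 2 Re g(c) / R` at the center. -/
theorem norm_deriv_le_of_re_pos {g : ℂ → ℂ} {c : ℂ} {R : ℝ} (hR : 0 < R)
    (hd : DifferentiableOn ℂ g (Metric.ball c R)) (hpos : ∀ w ∈ Metric.ball c R, 0 < (g w).re) :
    ‖deriv g c‖ ≤ 2 * (g c).re / R := by
  have hc : c ∈ Metric.ball c R := Metric.mem_ball_self hR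
  have hc0 := hpos c hc
  set b : ℂ := (starRingEnd ℂ) (g c) with hb
  have hbre : b.re = (g c).re := by simp [hb]
  have hne : ∀ w ∈ Metric.ball c R, g w + b ≠ 0 := fun w hw h0 => by
    have := congrArg Complex.re h0
    have := hpos w hw
    simp only [Complex.add_re, Complex.zero_re] at *
    linarith
  set h : ℂ → ℂ := fun w => (g w - g c) / (g w + b) with hh
  have hdh : DifferentiableOn ℂ h (Metric.ball c R) :=
    (hd.sub_const _).div (hd.add_const _) hne
  have hhc : h c = 0 := by simp [hh]
  have hmaps : MapsTo h (Metric.ball c R) (Metric.closedBall (h c) 1) := by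
    intro w hw
    rw [hhc, mem_closedBall_zero_iff, hh]
    simp only [norm_div]
    refine div_le_one_of_le₀ ?_ (norm_nonneg _)
    rw [← sq_le_sq₀ (norm_nonneg _) (norm_nonneg _), ← Complex.normSq_eq_norm_sq,
      ← Complex.normSq_eq_norm_sq, Complex.normSq_apply, Complex.normSq_apply]
    have := hpos w hw
    simp only [hb, Complex.add_re, Complex.add_im, Complex.sub_re, Complex.sub_im,
      Complex.conj_re, Complex.conj_im]
    nlinarith [mul_pos this hc0]
  have hS := Complex.norm_deriv_le_div_of_mapsTo_ball hdh hmaps hR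
  have hg := (hd.differentiableAt (Metric.isOpen_ball.mem_nhds hc)).hasDerivAt
  have hder : HasDerivAt h (deriv g c / (g c + b)) c := by
    refine ((hg.sub_const (g c)).fun_div (hg.add_const b) (hne c hc)).congr_deriv ?_
    have := hne c hc
    field_simp
    ring
  have hsum : g c + b = ((2 * (g c).re : ℝ) : ℂ) := by
    rw [hb, Complex.add_conj]
  rw [hder.deriv, hsum, norm_div, Complex.norm_real, Real.norm_of_nonneg (by positivity),
    div_le_div_iff₀ (by positivity) hR] at hS
  rw [le_div_iff₀ hR]
  linarith

/-- An injective local diffeomorphism on an open set has open image and a differentiable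
inverse. -/
theorem exists_inverse_of_injOn {S : Set (ℝ × ℝ)} (hS : IsOpen S) {ζ : ℝ × ℝ → ℂ}
    {ζ' : ℝ × ℝ → ((ℝ × ℝ) ≃L[ℝ] ℂ)}
    (hζ : ∀ z ∈ S, HasStrictFDerivAt ζ (ζ' z : (ℝ × ℝ) →L[ℝ] ℂ) z) (hinj : InjOn ζ S) :
    IsOpen (ζ '' S) ∧ ∃ η : ℂ → ℝ × ℝ, ∀ z ∈ S, η (ζ z) = z ∧
      HasFDerivAt η ((ζ' z).symm : ℂ →L[ℝ] ℝ × ℝ) (ζ z) := by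
  have hopen : IsOpen (ζ '' S) := by
    rw [isOpen_iff_mem_nhds]
    rintro _ ⟨z, hz, rfl⟩
    rw [← (hζ z hz).map_nhds_eq_of_equiv]
    exact image_mem_map (hS.mem_nhds hz)
  refine ⟨hopen, Function.invFunOn ζ S, fun z hz => ?_⟩
  have hleft : ∀ z ∈ S, Function.invFunOn ζ S (ζ z) = z := fun z hz => hinj.leftInvOn_invFunOn hz
  refine ⟨hleft z hz, HasFDerivAt.of_local_left_inverse (f := ζ) ?_ ?_ ?_⟩
  · rw [ContinuousAt, ← (hζ z hz).map_nhds_eq_of_equiv, tendsto_map'_iff, hleft z hz]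
    refine tendsto_id.congr' ?_
    filter_upwards [hS.mem_nhds hz] with w hw
    exact (hleft w hw).symm
  · rw [hleft z hz]
    exact (hζ z hz).hasFDerivAt
  · filter_upwards [hopen.mem_nhds (mem_image_of_mem ζ hz)] with w hw
    exact Function.invFunOn_eq hw

/-- If `ζ` expands lengths at least as much as `f` does, and the sets `{‖f - f z₀‖ ≤ r}` are compact
for `r < R`, then the image of `ζ` contains the disc of radius `R` about `ζ z₀`. -/
theorem ball_subset_image {F : Type*} [NormedAddCommGroup F] [NormedSpace ℝ F]
    {S : Set (ℝ × ℝ)} (hS : IsOpen S) {ζ : ℝ × ℝ → ℂ}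
    {ζ' : ℝ × ℝ → ((ℝ × ℝ) ≃L[ℝ] ℂ)}
    (hζ : ∀ z ∈ S, HasStrictFDerivAt ζ (ζ' z : (ℝ × ℝ) →L[ℝ] ℂ) z) (hinj : InjOn ζ S)
    {f : ℝ × ℝ → F} {f' : ℝ × ℝ → (ℝ × ℝ) →L[ℝ] F} (hf : ∀ z ∈ S, HasFDerivAt f (f' z) z)
    (hle : ∀ z ∈ S, ∀ v, ‖f' z v‖ ≤ ‖ζ' z v‖) {z₀ : ℝ × ℝ} (hz₀ : z₀ ∈ S) {R : ℝ}
    (hK : ∀ r < R, IsCompact {z ∈ S | ‖f z - f z₀‖ ≤ r}) :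
    Metric.ball (ζ z₀) R ⊆ ζ '' S := by
  obtain ⟨hopen, η, hη⟩ := exists_inverse_of_injOn hS hζ hinj
  by_contra hcon
  obtain ⟨w, hwR, hwV⟩ := not_subset.1 hcon
  obtain ⟨b, ⟨hbr, hbV⟩, hbmin⟩ :=
    ((isCompact_closedBall (ζ z₀) (dist w (ζ z₀))).inter_right hopen.isClosed_compl).exists_isMinOn
      ⟨w, Metric.mem_closedBall.2 le_rfl, hwV⟩
      (continuous_id.dist continuous_const : Continuous fun b => dist b (ζ z₀)).continuousOn
  set d := dist b (ζ z₀) with hd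
  have hdR : d < R := (Metric.mem_closedBall.1 hbr).trans_lt (Metric.mem_ball.1 hwR)
  have hd0 : d ≠ 0 := fun h => hbV (by rw [dist_eq_zero.1 h]; exact mem_image_of_mem ζ hz₀)
  have hball : Metric.ball (ζ z₀) d ⊆ ζ '' S := by
    intro c hc
    by_contra hcV
    have hcd := Metric.mem_ball.1 hc
    have : d ≤ dist c (ζ z₀) := hbmin ⟨Metric.mem_closedBall.2
      (hcd.le.trans (Metric.mem_closedBall.1 hbr)), hcV⟩
    exact absurd hcd this.not_gt
  have hlip : ∀ c ∈ Metric.ball (ζ z₀) d, ‖f (η c) - f (η (ζ z₀))‖ ≤ 1 * ‖c - ζ z₀‖ := by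
    intro c hc
    refine (convex_ball (ζ z₀) d).norm_image_sub_le_of_norm_hasFDerivWithin_le
      (f := fun c => f (η c)) (f' := fun c => (f' (η c)).comp ((ζ' (η c)).symm : ℂ →L[ℝ] ℝ × ℝ))
      (𝕜 := ℝ) ?_ ?_ (Metric.mem_ball_self (lt_of_le_of_ne dist_nonneg hd0.symm)) hc
    · intro c hc
      obtain ⟨z, hz, rfl⟩ := hball hc
      obtain ⟨h1, h2⟩ := hη z hz
      refine HasFDerivAt.hasFDerivWithinAt ?_
      refine HasFDerivAt.comp (g := f) (f := η) _ ?_ ?_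
      · rw [h1]; exact hf z hz
      · rw [h1]; exact h2
    · intro c hc
      obtain ⟨z, hz, rfl⟩ := hball hc
      refine ContinuousLinearMap.opNorm_le_bound _ zero_le_one fun v => ?_
      rw [(hη z hz).1, one_mul]
      simpa using hle z hz ((ζ' z).symm v)
  have hsub : Metric.ball (ζ z₀) d ⊆ ζ '' {z ∈ S | ‖f z - f z₀‖ ≤ d} := by
    intro c hc
    have h1 := hlip c hc
    obtain ⟨z, hz, rfl⟩ := hball hc
    rw [(hη z hz).1, (hη z₀ hz₀).1, one_mul, ← dist_eq_norm (ζ z)] at h1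
    exact ⟨z, ⟨hz, h1.trans (Metric.mem_ball.1 hc).le⟩, rfl⟩
  have hclosed : IsClosed (ζ '' {z ∈ S | ‖f z - f z₀‖ ≤ d}) :=
    ((hK d hdR).image_of_continuousOn fun z hz =>
      (hζ z hz.1).continuousAt.continuousWithinAt).isClosed
  have := closure_minimal hsub hclosed
  rw [closure_ball _ hd0] at this
  obtain ⟨z, hz, hzb⟩ := this (Metric.mem_closedBall.2 le_rfl : b ∈ Metric.closedBall (ζ z₀) d)
  exact hbV ⟨z, hz.1, hzb⟩

/-- The complex-valued linear map with given real and imaginary parts. -/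
noncomputable def complexPair (f g : (ℝ × ℝ) →L[ℝ] ℝ) : (ℝ × ℝ) →L[ℝ] ℂ :=
  (Complex.equivRealProdCLM.symm : (ℝ × ℝ) →L[ℝ] ℂ).comp (f.prod g)

theorem complexPair_apply (f g : (ℝ × ℝ) →L[ℝ] ℝ) (v : ℝ × ℝ) :
    complexPair f g v = ⟨f v, g v⟩ := by
  apply Complex.ext <;> simp [complexPair]

theorem hasFDerivAt_complexPair {f g : ℝ × ℝ → ℝ} {f' g' : (ℝ × ℝ) →L[ℝ] ℝ} {z : ℝ × ℝ}
    (hf : HasFDerivAt f f' z) (hg : HasFDerivAt g g' z) :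
    HasFDerivAt (fun z => (⟨f z, g z⟩ : ℂ)) (complexPair f' g') z := by
  refine (((Complex.equivRealProdCLM.symm : (ℝ × ℝ) →L[ℝ] ℂ).hasFDerivAt).comp z
    (hf.prodMk hg)).congr_of_eventuallyEq (Eventually.of_forall fun w => ?_)
  apply Complex.ext <;> simp

/-- The linear form `b dx + c dy`. -/
noncomputable def linearForm (b c : ℝ) : (ℝ × ℝ) →L[ℝ] ℝ :=
  b • ContinuousLinearMap.fst ℝ ℝ ℝ + c • ContinuousLinearMap.snd ℝ ℝ ℝ

theorem linearForm_apply (b c : ℝ) (v : ℝ × ℝ) : linearForm b c v = b * v.1 + c * v.2 := by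
  simp [linearForm]

/-- The differential of the isothermal coordinate `(x + F) + i (y + G)`, where
`dF = α dx + β dy` and `dG = β dx + γ dy`. -/
noncomputable def isothermalDiff (α β γ : ℝ) : (ℝ × ℝ) →L[ℝ] ℂ :=
  complexPair (linearForm (1 + α) β) (linearForm β (1 + γ))

theorem norm_isothermalDiff_sq {α β γ : ℝ} (h : α * γ - β ^ 2 = 1) (v : ℝ × ℝ) :
    ‖isothermalDiff α β γ v‖ ^ 2 =
      (2 + α + γ) * (α * v.1 ^ 2 + 2 * β * v.1 * v.2 + γ * v.2 ^ 2) := by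
  rw [isothermalDiff, complexPair_apply, ← Complex.normSq_eq_norm_sq, Complex.normSq_apply]
  simp only [linearForm_apply]
  linear_combination (-(v.1 ^ 2 + v.2 ^ 2)) * h

/-- Conformality: `x + i G` is holomorphic with respect to the isothermal coordinate. -/
theorem isothermalDiff_conformal {α β γ : ℝ} (h : α * γ - β ^ 2 = 1) (v : ℝ × ℝ) :
    complexPair (linearForm 1 0) (linearForm β γ) v * isothermalDiff α β γ (0, 1) =
      complexPair (linearForm 1 0) (linearForm β γ) (0, 1) * isothermalDiff α β γ v := by
  apply Complex.ext
  · simp [isothermalDiff, complexPair_apply, linearForm_apply]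
    ring
  · simp [isothermalDiff, complexPair_apply, linearForm_apply]
    linear_combination v.1 * (-h)

theorem isothermal_det {p q W : ℝ} (hW : 0 < W) (hW2 : W ^ 2 = 1 + p ^ 2 + q ^ 2) :
    (1 + p ^ 2) / W * ((1 + q ^ 2) / W) - (p * q / W) ^ 2 = 1 := by
  field_simp
  linear_combination -hW2

theorem norm_isothermalDiff_sq_of_graph {p q W : ℝ} (hW : 0 < W)
    (hW2 : W ^ 2 = 1 + p ^ 2 + q ^ 2) (v : ℝ × ℝ) :
    ‖isothermalDiff ((1 + p ^ 2) / W) (p * q / W) ((1 + q ^ 2) / W) v‖ ^ 2 =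
      (1 + 1 / W) ^ 2 * (v.1 ^ 2 + v.2 ^ 2 + (p * v.1 + q * v.2) ^ 2) := by
  rw [norm_isothermalDiff_sq (isothermal_det hW hW2)]
  field_simp
  linear_combination (-(v.1 ^ 2 + v.2 ^ 2 + (p * v.1 + q * v.2) ^ 2)) * hW2

theorem graph_norm_le_norm_isothermalDiff {p q W : ℝ} (hW : 0 < W)
    (hW2 : W ^ 2 = 1 + p ^ 2 + q ^ 2) (v : ℝ × ℝ) :
    v.1 ^ 2 + v.2 ^ 2 + (p * v.1 + q * v.2) ^ 2 ≤
      ‖isothermalDiff ((1 + p ^ 2) / W) (p * q / W) ((1 + q ^ 2) / W) v‖ ^ 2 := by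
  rw [norm_isothermalDiff_sq_of_graph hW hW2]
  have : 0 < 1 / W := by positivity
  exact le_mul_of_one_le_left (by positivity) (by nlinarith)

/-- A linear map `ℝ² → ℂ` which does not decrease the Euclidean norm is an isomorphism. -/
theorem exists_equiv_of_norm_ge {L : (ℝ × ℝ) →L[ℝ] ℂ}
    (hL : ∀ v : ℝ × ℝ, v.1 ^ 2 + v.2 ^ 2 ≤ ‖L v‖ ^ 2) :
    ∃ e : (ℝ × ℝ) ≃L[ℝ] ℂ, (e : (ℝ × ℝ) →L[ℝ] ℂ) = L := by
  have hinj : Function.Injective (L : (ℝ × ℝ) →ₗ[ℝ] ℂ) := by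
    rw [injective_iff_map_eq_zero]
    intro v hv
    have h := hL v
    have hv' : L v = 0 := hv
    rw [hv'] at h
    simp only [norm_zero] at h
    ext
    · simp only [Prod.fst_zero]; nlinarith [sq_nonneg v.1, sq_nonneg v.2]
    · simp only [Prod.snd_zero]; nlinarith [sq_nonneg v.1, sq_nonneg v.2]
  refine ⟨(LinearEquiv.ofInjectiveOfFinrankEq (L : (ℝ × ℝ) →ₗ[ℝ] ℂ) hinj
    (by simp)).toContinuousLinearEquiv, ?_⟩
  ext <;> rfl

theorem isothermalDiff_eq (α β γ : ℝ) : isothermalDiff α β γ =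
    (1 + α) • complexPair (linearForm 1 0) 0 + β • complexPair (linearForm 0 1) (linearForm 1 0) +
      (1 + γ) • complexPair 0 (linearForm 0 1) := by
  refine ContinuousLinearMap.ext fun v => ?_
  apply Complex.ext <;> simp [isothermalDiff, complexPair_apply, linearForm_apply]

/-- A strictly monotone vector field on a convex set is injective. -/
theorem injOn_of_inner_pos {S : Set (ℝ × ℝ)} (hc : Convex ℝ S) {ζ : ℝ × ℝ → ℂ}
    {L : ℝ × ℝ → (ℝ × ℝ) →L[ℝ] ℂ} (hζ : ∀ z ∈ S, HasFDerivAt ζ (L z) z)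
    (hpos : ∀ z ∈ S, ∀ v ≠ 0, 0 < (L z v).re * v.1 + (L z v).im * v.2) : InjOn ζ S := by
  intro z hz w hw hzw
  by_contra hne
  set v := w - z with hv
  have hline : ∀ t ∈ Set.Icc (0 : ℝ) 1, z + t • v ∈ S := fun t ht =>
    hc.add_smul_sub_mem hz hw ht
  have hder : ∀ t ∈ Set.Icc (0 : ℝ) 1, HasDerivAt
      (fun t : ℝ => (ζ (z + t • v)).re * v.1 + (ζ (z + t • v)).im * v.2)
      ((L (z + t • v) v).re * v.1 + (L (z + t • v) v).im * v.2) t := by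
    intro t ht
    have h1 : HasDerivAt (fun t : ℝ => z + t • v) v t := by
      simpa using ((hasDerivAt_id t).smul_const v).const_add z
    have h2 : HasDerivAt (fun t : ℝ => ζ (z + t • v)) (L (z + t • v) v) t :=
      (hζ _ (hline t ht)).comp_hasDerivAt t h1
    exact ((Complex.reCLM.hasFDerivAt.comp_hasDerivAt t h2).mul_const v.1).add
      ((Complex.imCLM.hasFDerivAt.comp_hasDerivAt t h2).mul_const v.2)
  obtain ⟨t, ht, h0⟩ := exists_hasDerivAt_eq_zero zero_lt_one
    (fun t ht => (hder t ht).continuousAt.continuousWithinAt)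
    (by simp [hv, hzw]) fun t ht => hder t (Set.Ioo_subset_Icc_self ht)
  exact (hpos _ (hline t (Set.Ioo_subset_Icc_self ht)) v
    (sub_ne_zero.2 (Ne.symm hne))).ne' h0

/-- The isothermal coordinate of a minimal graph over a convex domain, bundled with the holomorphic
function `x + i x*` where `x*` is the conjugate of `x`. -/
theorem IsMSESolution.exists_isothermal {S : Set (ℝ × ℝ)} (hS : IsOpen S) (hc : Convex ℝ S)
    {u : ℝ × ℝ → ℝ} (hu : IsMSESolution S u) :
    ∃ ζ A : ℝ × ℝ → ℂ, InjOn ζ S ∧ (∀ z, (A z).re = z.1) ∧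
      (∀ z ∈ S, HasStrictFDerivAt ζ (isothermalDiff ((1 + pd1 u z ^ 2) / Wf u z)
        (pd1 u z * pd2 u z / Wf u z) ((1 + pd2 u z ^ 2) / Wf u z)) z) ∧
      ∀ z ∈ S, HasFDerivAt A (complexPair (linearForm 1 0)
        (linearForm (pd1 u z * pd2 u z / Wf u z) ((1 + pd2 u z ^ 2) / Wf u z))) z := by
  obtain ⟨⟨F, hF⟩, G, hG⟩ := hu.exists_primitives hS hc
  set L : ℝ × ℝ → (ℝ × ℝ) →L[ℝ] ℂ := fun z => isothermalDiff ((1 + pd1 u z ^ 2) / Wf u z)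
        (pd1 u z * pd2 u z / Wf u z) ((1 + pd2 u z ^ 2) / Wf u z) with hL
  have hζ : ∀ z ∈ S, HasFDerivAt (fun z : ℝ × ℝ => (⟨z.1 + F z, z.2 + G z⟩ : ℂ)) (L z) z := by
    intro z hz
    refine (hasFDerivAt_complexPair (hasFDerivAt_fst.add (hF z hz))
      (hasFDerivAt_snd.add (hG z hz))).congr_fderiv ?_
    ext <;> simp [hL, isothermalDiff, complexPair_apply, linearForm_apply]
  have hA : ∀ z ∈ S, HasFDerivAt (fun z : ℝ × ℝ => (⟨z.1, G z⟩ : ℂ)) (complexPair (linearForm 1 0)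
        (linearForm (pd1 u z * pd2 u z / Wf u z) ((1 + pd2 u z ^ 2) / Wf u z))) z := by
    intro z hz
    refine (hasFDerivAt_complexPair hasFDerivAt_fst (hG z hz)).congr_fderiv ?_
    ext <;> simp [complexPair_apply, linearForm_apply]
  have hp : ContinuousOn (pd1 u) S := (contDiffOn_fderiv_apply hS hu.1 (1, 0)).continuousOn
  have hq : ContinuousOn (pd2 u) S := (contDiffOn_fderiv_apply hS hu.1 (0, 1)).continuousOn
  have hWc : ContinuousOn (Wf u) S :=
    ((continuousOn_const.add (hp.pow 2)).add (hq.pow 2)).sqrt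
  have hWn : ∀ z ∈ S, Wf u z ≠ 0 := fun z _ => (Wf_pos u z).ne'
  have hα := (continuousOn_const (c := (1 : ℝ)).add (hp.pow 2)).div hWc hWn
  have hβ := (hp.mul hq).div hWc hWn
  have hγ := (continuousOn_const (c := (1 : ℝ)).add (hq.pow 2)).div hWc hWn
  have hLc : ContinuousOn L S := by
    refine ((((continuousOn_const (c := (1 : ℝ)).add hα).smul continuousOn_const).add
      (hβ.smul continuousOn_const)).add
      ((continuousOn_const (c := (1 : ℝ)).add hγ).smul continuousOn_const)).congr fun z _ =>
        isothermalDiff_eq _ _ _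
  refine ⟨_, _, injOn_of_inner_pos hc hζ fun z _ v hv => ?_, fun z => rfl,
    fun z hz => hasStrictFDerivAt_of_hasFDerivAt_of_continuousAt
      (eventually_of_mem (hS.mem_nhds hz) hζ) (hLc.continuousAt (hS.mem_nhds hz)), hA⟩
  have hW := Wf_pos u z
  have hv2 : 0 < v.1 ^ 2 + v.2 ^ 2 := by
    by_contra! h
    exact hv (Prod.ext (by simp only [Prod.fst_zero]; nlinarith [sq_nonneg v.1, sq_nonneg v.2])
      (by simp only [Prod.snd_zero]; nlinarith [sq_nonneg v.1, sq_nonneg v.2]))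
  have : (L z v).re * v.1 + (L z v).im * v.2 = v.1 ^ 2 + v.2 ^ 2 +
      (v.1 ^ 2 + v.2 ^ 2 + (pd1 u z * v.1 + pd2 u z * v.2) ^ 2) / Wf u z := by
    simp only [hL, isothermalDiff, complexPair_apply, linearForm_apply]
    field_simp
    ring
  rw [this]
  positivity

/-- Compactness of the pieces of the graph at bounded height and bounded distance from the end of
the half-strip. -/
theorem isCompact_halfStrip_piece {a : ℝ} {u : ℝ × ℝ → ℝ}
    {S : Set (ℝ × ℝ)} (hS : S = Set.Ioo (0 : ℝ) a ×ˢ Set.Ioi (0 : ℝ))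
    (hu : ContinuousOn u S)
    (hleft : ∀ y₀ : ℝ, 0 < y₀ → Tendsto u (nhdsWithin ((0 : ℝ), y₀) S) atBot)
    (hright : ∀ y₀ : ℝ, 0 < y₀ → Tendsto u (nhdsWithin ((a : ℝ), y₀) S) atTop)
    {y h r : ℝ} (hr : r < y) :
    IsCompact {z ∈ S | ‖(z.2, u z) - (y, h)‖ ≤ r} := by
  set K := {z ∈ S | ‖(z.2, u z) - (y, h)‖ ≤ r} with hKdef
  have hKS : K ⊆ S := fun z hz => hz.1
  have hKy : ∀ z ∈ K, |z.2 - y| ≤ r := fun z hz => (norm_fst_le _).trans hz.2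
  have hKu : ∀ z ∈ K, |u z - h| ≤ r := fun z hz => (norm_snd_le _).trans hz.2
  have hsub : K ⊆ Set.Icc 0 a ×ˢ Set.Icc (y - r) (y + r) := by
    intro z hz
    have h1 := hKS hz
    rw [hS] at h1
    have h2 := abs_le.1 (hKy z hz)
    exact ⟨⟨h1.1.1.le, h1.1.2.le⟩, by linarith, by linarith⟩
  have hrect : IsCompact (Set.Icc 0 a ×ˢ Set.Icc (y - r) (y + r)) :=
    isCompact_Icc.prod isCompact_Icc
  refine hrect.of_isClosed_subset (isClosed_of_closure_subset fun z hz => ?_) hsub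
  have hzr := closure_minimal hsub hrect.isClosed hz
  have hne : (nhdsWithin z K).NeBot := mem_closure_iff_nhdsWithin_neBot.1 hz
  have hz2 : 0 < z.2 := by have := hzr.2.1; linarith
  have hmem : ∀ᶠ w in nhdsWithin z K, w ∈ K := self_mem_nhdsWithin
  have hz0 : z.1 ≠ 0 := by
    intro h0
    have ht : Tendsto u (nhdsWithin z K) atBot := by
      have := hleft z.2 hz2
      rw [← h0] at this
      exact this.mono_left (nhdsWithin_mono _ hKS)
    obtain ⟨w, hw, hwK⟩ := ((ht.eventually (eventually_lt_atBot (h - r))).and hmem).exists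
    have := abs_le.1 (hKu w hwK)
    linarith
  have hza : z.1 ≠ a := by
    intro h0
    have ht : Tendsto u (nhdsWithin z K) atTop := by
      have := hright z.2 hz2
      rw [← h0] at this
      exact this.mono_left (nhdsWithin_mono _ hKS)
    obtain ⟨w, hw, hwK⟩ := ((ht.eventually (eventually_gt_atTop (h + r))).and hmem).exists
    have := abs_le.1 (hKu w hwK)
    linarith
  have hzS : z ∈ S := by
    rw [hS]
    exact ⟨⟨lt_of_le_of_ne hzr.1.1 hz0.symm, lt_of_le_of_ne hzr.1.2 hza⟩, hz2⟩
  have ht : Tendsto (fun w : ℝ × ℝ => ‖(w.2, u w) - (y, h)‖) (nhdsWithin z K)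
      (nhds ‖(z.2, u z) - (y, h)‖) :=
    (((continuous_snd.continuousWithinAt).prodMk ((hu z hzS).mono hKS)).sub
      continuousWithinAt_const).norm
  exact ⟨hzS, le_of_tendsto ht (hmem.mono fun w hw => hw.2)⟩

/-- On a half-strip of width `a` with infinite boundary values on the sides,
`√(1 + q²) ≤ (a / y) (1 + W)`. -/
theorem one_add_pd2_sq_le {a : ℝ} {u : ℝ × ℝ → ℝ}
    {S : Set (ℝ × ℝ)} (hS : S = Set.Ioo (0 : ℝ) a ×ˢ Set.Ioi (0 : ℝ))
    (hu : IsMSESolution S u)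
    (hleft : ∀ y₀ : ℝ, 0 < y₀ → Tendsto u (nhdsWithin ((0 : ℝ), y₀) S) atBot)
    (hright : ∀ y₀ : ℝ, 0 < y₀ → Tendsto u (nhdsWithin ((a : ℝ), y₀) S) atTop)
    {z₀ : ℝ × ℝ} (hz₀ : z₀ ∈ S) :
    1 + pd2 u z₀ ^ 2 ≤ (a / z₀.2) ^ 2 * (1 + Wf u z₀) ^ 2 := by
  have hSo : IsOpen S := hS ▸ isOpen_Ioo.prod isOpen_Ioi
  have hSc : Convex ℝ S := hS ▸ (convex_Ioo 0 a).prod (convex_Ioi 0)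
  have hmem : ∀ z ∈ S, (0 < z.1 ∧ z.1 < a) ∧ 0 < z.2 := fun z hz => by rw [hS] at hz; exact hz
  obtain ⟨ζ, A, hinj, hAre, hζ, hA⟩ := hu.exists_isothermal hSo hSc
  have hgr := fun z => graph_norm_le_norm_isothermalDiff (Wf_pos u z) (Wf_sq u z)
  choose ζ' hζ' using fun z => exists_equiv_of_norm_ge
    (fun v => (le_add_of_nonneg_right (sq_nonneg _)).trans (hgr z v))
  simp only [← hζ'] at hζ
  have hud : ∀ z ∈ S, DifferentiableAt ℝ u z := fun z hz =>
    (hu.1.differentiableOn (by norm_num)).differentiableAt (hSo.mem_nhds hz)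
  have hball : Metric.ball (ζ z₀) z₀.2 ⊆ ζ '' S := by
    refine ball_subset_image hSo hζ hinj (f := fun z => (z.2, u z))
      (f' := fun z => (ContinuousLinearMap.snd ℝ ℝ ℝ).prod (fderiv ℝ u z))
      (fun z hz => hasFDerivAt_snd.prodMk (hud z hz).hasFDerivAt) ?_ hz₀
      fun r hr => isCompact_halfStrip_piece hS hu.1.continuousOn hleft hright hr
    intro z _ v
    have h1 := hgr z v
    rw [← hζ'] at h1
    have hv : fderiv ℝ u z v = pd1 u z * v.1 + pd2 u z * v.2 := by
      have : v = v.1 • ((1 : ℝ), (0 : ℝ)) + v.2 • ((0 : ℝ), (1 : ℝ)) := by ext <;> simp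
      conv_lhs => rw [this]
      simp only [map_add, map_smul, smul_eq_mul, pd1, pd2]
      ring
    refine max_le ?_ ?_
    · refine abs_le_of_sq_le_sq (le_trans ?_ h1) (norm_nonneg _)
      change v.2 ^ 2 ≤ _
      nlinarith [sq_nonneg v.1, sq_nonneg (pd1 u z * v.1 + pd2 u z * v.2)]
    · refine abs_le_of_sq_le_sq (le_trans ?_ h1) (norm_nonneg _)
      change (fderiv ℝ u z v) ^ 2 ≤ _
      rw [hv]
      nlinarith [sq_nonneg v.1, sq_nonneg v.2]
  obtain ⟨-, η, hη⟩ := exists_inverse_of_injOn hSo hζ hinj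
  have hL0 : ∀ z, ζ' z (0, 1) ≠ 0 := fun z => by simp
  have hder : ∀ z ∈ S, HasDerivAt (fun w => A (η w))
      (complexPair (linearForm 1 0) (linearForm (pd1 u z * pd2 u z / Wf u z)
        ((1 + pd2 u z ^ 2) / Wf u z)) (0, 1) / ζ' z (0, 1)) (ζ z) := by
    intro z hz
    obtain ⟨h1, h2⟩ := hη z hz
    have h3 : HasFDerivAt (fun w => A (η w)) _ (ζ z) :=
      HasFDerivAt.comp (g := A) (f := η) (ζ z) (by rw [h1]; exact hA z hz) h2
    refine (hasFDerivAt_of_restrictScalars ℝ (f' := ContinuousLinearMap.toSpanSingleton ℂ _) h3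
      (ContinuousLinearMap.ext fun w => ?_)).hasDerivAt.congr_deriv
        (ContinuousLinearMap.toSpanSingleton_apply_one ..)
    have hconf := isothermalDiff_conformal (isothermal_det (Wf_pos u z) (Wf_sq u z))
      ((ζ' z).symm w)
    rw [← hζ'] at hconf
    simp only [ContinuousLinearEquiv.coe_coe, ContinuousLinearEquiv.apply_symm_apply] at hconf
    simp only [ContinuousLinearMap.coe_restrictScalars', ContinuousLinearMap.comp_apply,
      ContinuousLinearEquiv.coe_coe, ContinuousLinearMap.toSpanSingleton_apply, smul_eq_mul]
    rw [mul_div_assoc', div_eq_iff (hL0 z), hconf, mul_comm]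
  have hz0 := hmem z₀ hz₀
  have hdiff : DifferentiableOn ℂ (fun w => A (η w)) (Metric.ball (ζ z₀) z₀.2) := by
    intro w hw
    obtain ⟨z, hz, rfl⟩ := hball hw
    exact (hder z hz).differentiableAt.differentiableWithinAt
  have hre : ∀ w ∈ Metric.ball (ζ z₀) z₀.2, 0 < (A (η w)).re ∧ (A (η w)).re < a := by
    intro w hw
    obtain ⟨z, hz, rfl⟩ := hball hw
    rw [(hη z hz).1, hAre]
    exact (hmem z hz).1
  have hb1 := norm_deriv_le_of_re_pos hz0.2 hdiff fun w hw => (hre w hw).1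
  have hb2 := norm_deriv_le_of_re_pos hz0.2 (hdiff.const_sub (a : ℂ)) fun w hw => by
    simpa using (hre w hw).2
  rw [(hη z₀ hz₀).1, hAre, (hder z₀ hz₀).deriv] at hb1
  rw [((hder z₀ hz₀).const_sub (a : ℂ)).deriv, norm_neg, (hη z₀ hz₀).1, Complex.sub_re, hAre,
    Complex.ofReal_re] at hb2
  have hb : ‖complexPair (linearForm 1 0) (linearForm (pd1 u z₀ * pd2 u z₀ / Wf u z₀)
        ((1 + pd2 u z₀ ^ 2) / Wf u z₀)) (0, 1) / ζ' z₀ (0, 1)‖ ≤ a / z₀.2 := by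
    have hadd := add_le_add hb1 hb2
    rw [show 2 * z₀.1 / z₀.2 + 2 * (a - z₀.1) / z₀.2 = 2 * (a / z₀.2) by ring] at hadd
    linarith
  have hW := Wf_pos u z₀
  have hn := norm_isothermalDiff_sq_of_graph hW (Wf_sq u z₀) (0, 1)
  rw [← hζ'] at hn
  rw [norm_div, div_le_iff₀ (norm_pos_iff.2 (hL0 z₀)), complexPair_apply] at hb
  have him := (Complex.abs_im_le_norm _).trans hb
  simp only [linearForm_apply, mul_zero, mul_one, zero_add] at him
  rw [abs_of_pos (by positivity)] at him
  have hsq := pow_le_pow_left₀ (by positivity) him 2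
  rw [mul_pow, ← ContinuousLinearEquiv.coe_coe, hn] at hsq
  have hq : 0 < 1 + pd2 u z₀ ^ 2 := by positivity
  have h1 : ((1 + pd2 u z₀ ^ 2) / Wf u z₀) ^ 2 * Wf u z₀ ^ 2 =
      (1 + pd2 u z₀ ^ 2) * (1 + pd2 u z₀ ^ 2) := by
    field_simp
  have h2 : (a / z₀.2) ^ 2 * ((1 + 1 / Wf u z₀) ^ 2 * ((0 : ℝ) ^ 2 + 1 ^ 2 +
      (pd1 u z₀ * 0 + pd2 u z₀ * 1) ^ 2)) * Wf u z₀ ^ 2 =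
      (a / z₀.2) ^ 2 * (1 + Wf u z₀) ^ 2 * (1 + pd2 u z₀ ^ 2) := by
    field_simp
    ring
  have h3 := mul_le_mul_of_nonneg_right hsq (sq_nonneg (Wf u z₀))
  rw [h1] at h3
  exact le_of_mul_le_mul_right (h3.trans_eq h2) hq

/-- The algebraic passage from the bound on `1 + q²` to those on `|p| / W` and `|q| / W`. -/
theorem gradient_bounds_of_one_add_sq_le {p q W ε : ℝ} (hW : 0 < W)
    (hW2 : W ^ 2 = 1 + p ^ 2 + q ^ 2) (hε : 0 < ε) (hε4 : ε ≤ 1 / 4)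
    (h : 1 + q ^ 2 ≤ ε ^ 2 * (1 + W) ^ 2) :
    1 - ε ^ 2 ≤ |p| / W ∧ |q| / W ≤ √2 * ε := by
  have hk : 1 + q ^ 2 ≤ 16 / 9 * (ε * W) ^ 2 := by
    have h1 : √(1 + q ^ 2) ≤ ε * (1 + W) := by
      rw [Real.sqrt_le_left (by positivity), mul_pow]
      exact h
    have h2 : 1 ≤ √(1 + q ^ 2) := Real.one_le_sqrt.2 (by nlinarith)
    have h3 := Real.sq_sqrt (show 0 ≤ 1 + q ^ 2 by positivity)
    have h4 : √(1 + q ^ 2) ≤ 4 / 3 * (ε * W) := by nlinarith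
    nlinarith
  have hεW : 0 < ε * W := by positivity
  constructor
  · rw [le_div_iff₀ hW]
    refine (le_abs_self _).trans (sq_le_sq.1 ?_)
    have h1 : ε ^ 2 * (ε * W) ^ 2 ≤ 1 / 16 * (ε * W) ^ 2 :=
      mul_le_mul_of_nonneg_right (by nlinarith) (sq_nonneg _)
    nlinarith
  · rw [div_le_iff₀ hW]
    refine abs_le_of_sq_le_sq ?_ (by positivity)
    rw [mul_pow, mul_pow, Real.sq_sqrt (by norm_num), mul_assoc, ← mul_pow]
    nlinarith

/-- **Gradient estimate on a half-strip** (Lemma `jenkins` of the paper):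
if `u` solves the MSE on `(0,a) × (0,∞)` with boundary value `−∞` on the left side
and `+∞` on the right side, then for `y ≥ 4a` one has `|p|/W ≥ 1 − a²/y²` and
`|q|/W ≤ √2·a/y`. -/
theorem stmt_1 (a : ℝ) (ha : 0 < a) (u : ℝ × ℝ → ℝ)
    (S : Set (ℝ × ℝ)) (hS : S = Set.Ioo (0 : ℝ) a ×ˢ Set.Ioi (0 : ℝ))
    (hu : IsMSESolution S u)
    (hleft : ∀ y₀ : ℝ, 0 < y₀ → Tendsto u (nhdsWithin ((0 : ℝ), y₀) S) atBot)
    (hright : ∀ y₀ : ℝ, 0 < y₀ → Tendsto u (nhdsWithin ((a : ℝ), y₀) S) atTop) :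
    ∀ x y : ℝ, (x, y) ∈ S → 4 * a ≤ y →
      1 - a ^ 2 / y ^ 2 ≤ |pd1 u (x, y)| / Wf u (x, y) ∧
      |pd2 u (x, y)| / Wf u (x, y) ≤ Real.sqrt 2 * a / y := by
  intro x y hxy hy
  have hy0 : 0 < y := by linarith
  have hε4 : a / y ≤ 1 / 4 := by
    rw [div_le_div_iff₀ hy0 (by norm_num)]
    linarith
  have h := gradient_bounds_of_one_add_sq_le (Wf_pos u (x, y)) (Wf_sq u (x, y))
    (by positivity) hε4 (one_add_pd2_sq_le hS hu hleft hright hxy)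
  rwa [div_pow, ← mul_div_assoc] at h
end

section
/- Uniform interior bound along a ray for solutions of the minimal surface equation on a slit disk: Let ρ₀ > 0 and ε > 0. There exists d ∈ (0, ρ₀) such that for every α ∈ ℝ and every solution v of the minimal surface equation on the slit disk Ω_α = {ρ·(cos φ, sin φ) : 0 < ρ < ρ₀, α − π < φ < α + π} (the open disk of radius ρ₀ centered at the origin with the closed radius in the direction −(cos α, sin α) removed), one has for every ρ ∈ (0, ρ₀): v(ρ cos α, ρ sin α) ≤ sup{ v(ρ' cos φ, ρ' sin φ) : d ≤ ρ' < ρ₀, |φ − α| ≤ 3π/4 } + ε, and v(ρ cos α, ρ sin α) ≥ inf{ v(ρ' cos φ, ρ' sin φ) : d ≤ ρ' < ρ₀, |φ − α| ≤ 3π/4 } − ε. -/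
open Real Filter Set

/-- The slit disk of radius `ρ₀`: the open disk of radius `ρ₀` centered at the origin
with the closed radius in the direction `−(cos α, sin α)` removed, described in polar
coordinates. -/
def slitDisk (ρ₀ α : ℝ) : Set (ℝ × ℝ) :=
  {z : ℝ × ℝ | ∃ ρ φ : ℝ, 0 < ρ ∧ ρ < ρ₀ ∧ α - π < φ ∧ φ < α + π ∧
    z = (ρ * Real.cos φ, ρ * Real.sin φ)}

/-- Second-order necessary condition at a local maximum of a function of one real variable. -/
lemma IsLocalMax.second_deriv_nonpos {f f' : ℝ → ℝ} {f'' x : ℝ} (hmax : IsLocalMax f x)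
    (hf : ∀ᶠ t in nhds x, HasDerivAt f (f' t) t) (hf' : HasDerivAt f' f'' x) : f'' ≤ 0 := by
  have hderiv : deriv f =ᶠ[nhds x] f' := hf.mono fun t ht => ht.deriv
  have hsecond : deriv (deriv f) x = f'' := hderiv.deriv_eq.trans hf'.deriv
  by_contra! hpos
  have hmin : IsLocalMin f x :=
    isLocalMin_of_deriv_deriv_pos (hsecond ▸ hpos) hmax.deriv_eq_zero hf.self_of_nhds.continuousAt
  have hconst : f =ᶠ[nhds x] fun _ => f x := by
    filter_upwards [hmin, hmax] with t h₁ h₂ using le_antisymm h₂ h₁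
  have hzero : deriv (deriv f) x = 0 := by
    rw [hconst.deriv.deriv_eq]; simp
  linarith

/-- The power of the point `z` with respect to the circle of center `c` and squared radius `s`. -/
def circlePower (c : ℝ × ℝ) (s : ℝ) (z : ℝ × ℝ) : ℝ :=
  (z.1 - c.1) ^ 2 + (z.2 - c.2) ^ 2 - s

lemma continuous_circlePower (c : ℝ × ℝ) (s : ℝ) : Continuous (circlePower c s) := by
  unfold circlePower; fun_prop

lemma circlePower_add_smul (c : ℝ × ℝ) (s : ℝ) (z e : ℝ × ℝ) (t : ℝ) :
    circlePower c s (z + t • e) = circlePower c s z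
      + 2 * ((z.1 - c.1) * e.1 + (z.2 - c.2) * e.2) * t + (e.1 ^ 2 + e.2 ^ 2) * t ^ 2 := by
  simp only [circlePower, Prod.fst_add, Prod.snd_add, Prod.smul_fst, Prod.smul_snd, smul_eq_mul]
  ring

lemma tendsto_add_smul_nhds_zero (z e : ℝ × ℝ) :
    Tendsto (fun t : ℝ => z + t • e) (nhds 0) (nhds z) := by
  have : Continuous fun t : ℝ => z + t • e := by fun_prop
  simpa using this.tendsto 0

lemma hasDerivAt_add_smul (z e : ℝ × ℝ) (t : ℝ) : HasDerivAt (fun t : ℝ => z + t • e) e t := by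
  simpa using ((hasDerivAt_id t).smul_const e).const_add z

/-- First- and second-order conditions, in the direction `e`, at a local maximum of
`v + √(circlePower c s)` outside the circle. -/
lemma IsLocalMax.directional_conditions {v : ℝ × ℝ → ℝ} {c z : ℝ × ℝ} {s : ℝ}
    (hv : ContDiffAt ℝ 2 v z) (hz : 0 < circlePower c s z)
    (hmax : IsLocalMax (fun y => v y + √(circlePower c s y)) z) (e : ℝ × ℝ) :
    fderiv ℝ v z e
        + ((z.1 - c.1) * e.1 + (z.2 - c.2) * e.2) / √(circlePower c s z) = 0 ∧
      fderiv ℝ (fderiv ℝ v) z e e + ((e.1 ^ 2 + e.2 ^ 2) / √(circlePower c s z)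
        - ((z.1 - c.1) * e.1 + (z.2 - c.2) * e.2) ^ 2 / √(circlePower c s z) ^ 3) ≤ 0 := by
  set l := (z.1 - c.1) * e.1 + (z.2 - c.2) * e.2 with hl
  set n := e.1 ^ 2 + e.2 ^ 2 with hn
  set γ : ℝ → ℝ × ℝ := fun t => z + t • e with hγ
  have hγ0 : γ 0 = z := by simp [hγ]
  have htend : Tendsto γ (nhds 0) (nhds z) := tendsto_add_smul_nhds_zero z e
  have hpow : ∀ t, HasDerivAt (fun t => circlePower c s (γ t)) (2 * l + 2 * n * t) t := by
    intro t
    have h₁ : HasDerivAt (fun t : ℝ => circlePower c s z + 2 * l * t + n * t ^ 2)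
        (2 * l + 2 * n * t) t := by
      have := (((hasDerivAt_id t).const_mul (2 * l)).const_add (circlePower c s z)).add
        (((hasDerivAt_id t).pow 2).const_mul n)
      exact this.congr_deriv (by push_cast; simp only [id_eq]; ring)
    convert h₁ using 2 with u
    exact circlePower_add_smul c s z e u
  have hpos : ∀ᶠ t in nhds (0 : ℝ), 0 < circlePower c s (γ t) :=
    htend.eventually ((continuous_circlePower c s).continuousAt.eventually_const_lt hz)
  have hsqrt : ∀ t, 0 < circlePower c s (γ t) →
      HasDerivAt (fun t => √(circlePower c s (γ t)))
        ((2 * l + 2 * n * t) / (2 * √(circlePower c s (γ t)))) t :=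
    fun t ht => (hpow t).sqrt ht.ne'
  have hdiff : ∀ᶠ y in nhds z, DifferentiableAt ℝ v y :=
    (hv.eventually (by simp)).mono fun y hy => hy.differentiableAt (by simp)
  have hline : ∀ᶠ t in nhds (0 : ℝ), HasDerivAt (fun t => v (γ t) + √(circlePower c s (γ t)))
      (fderiv ℝ v (γ t) e + (2 * l + 2 * n * t) / (2 * √(circlePower c s (γ t)))) t := by
    filter_upwards [hpos, htend.eventually hdiff] with t ht hd
    exact (hd.hasFDerivAt.comp_hasDerivAt t (hasDerivAt_add_smul z e t)).add (hsqrt t ht)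
  have hlocal : IsLocalMax (fun t => v (γ t) + √(circlePower c s (γ t))) 0 := by
    filter_upwards [htend.eventually hmax] with t ht
    simpa [hγ0] using ht
  have hpos0 : 0 < circlePower c s (γ 0) := hγ0 ▸ hz
  have hroot : 0 < √(circlePower c s z) := sqrt_pos.mpr hz
  have hD : HasFDerivAt (fderiv ℝ v) (fderiv ℝ (fderiv ℝ v) z) (γ 0) := by
    rw [hγ0]
    exact ((hv.fderiv_right (m := 1) (by norm_num)).differentiableAt (by simp)).hasFDerivAt
  have hD' : HasDerivAt (fun t => fderiv ℝ v (γ t) e) (fderiv ℝ (fderiv ℝ v) z e e) 0 := by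
    have := (hD.comp_hasDerivAt (0 : ℝ) (hasDerivAt_add_smul z e 0)).clm_apply
      (hasDerivAt_const (0 : ℝ) e)
    simpa using this
  have hquot : HasDerivAt (fun t => (2 * l + 2 * n * t) / (2 * √(circlePower c s (γ t))))
      (n / √(circlePower c s z) - l ^ 2 / √(circlePower c s z) ^ 3) 0 := by
    have hnum : HasDerivAt (fun t : ℝ => 2 * l + 2 * n * t) (2 * n) 0 := by
      simpa using ((hasDerivAt_id (0 : ℝ)).const_mul (2 * n)).const_add (2 * l)
    have hne : 2 * √(circlePower c s (γ 0)) ≠ 0 := by rw [hγ0]; positivity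
    refine (hnum.div ((hsqrt 0 hpos0).const_mul 2) hne).congr_deriv ?_
    rw [hγ0]
    field_simp
    ring
  refine ⟨?_, hlocal.second_deriv_nonpos hline (hD'.add hquot)⟩
  have := hlocal.hasDerivAt_eq_zero hline.self_of_nhds
  rw [hγ0] at this
  rw [← this]
  field_simp
  ring

/-- The lower half `-√(circlePower c s)` of a hyperboloid is a strict supersolution of the minimal
surface equation, so a solution cannot touch a translate of it from below. -/
lemma not_isLocalMax_add_sqrt_circlePower {U : Set (ℝ × ℝ)} {v : ℝ × ℝ → ℝ} {c z : ℝ × ℝ} {s : ℝ}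
    (hv : IsMSESolution U v) (hU : U ∈ nhds z) (hz : 0 < circlePower c s z) :
    ¬ IsLocalMax (fun y => v y + √(circlePower c s y)) z := by
  intro hmax
  have hC : ContDiffAt ℝ 2 v z := hv.1.contDiffAt hU
  have hcond := IsLocalMax.directional_conditions hC hz hmax
  have hroot : 0 < √(circlePower c s z) := sqrt_pos.mpr hz
  have hmse := hv.2 z (mem_of_mem_nhds hU)
  have hdiff : DifferentiableAt ℝ (fderiv ℝ v) z :=
    (hC.fderiv_right (m := 1) (by norm_num)).differentiableAt (by simp)
  have hpartial : ∀ e w : ℝ × ℝ, fderiv ℝ (fun y => fderiv ℝ v y e) z w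
      = fderiv ℝ (fderiv ℝ v) z w e := by
    intro e w
    rw [fderiv_clm_apply hdiff (differentiableAt_const e)]
    simp
  have hsymm : fderiv ℝ (fderiv ℝ v) z (1, 0) (0, 1) = fderiv ℝ (fderiv ℝ v) z (0, 1) (1, 0) :=
    (hC.isSymmSndFDerivAt (by simp)) _ _
  have h₁₁ : pd1 (pd1 v) z = fderiv ℝ (fderiv ℝ v) z (1, 0) (1, 0) := hpartial _ _
  have h₁₂ : pd2 (pd1 v) z = fderiv ℝ (fderiv ℝ v) z (0, 1) (1, 0) := hpartial _ _
  have h₂₂ : pd2 (pd2 v) z = fderiv ℝ (fderiv ℝ v) z (0, 1) (0, 1) := hpartial _ _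
  obtain ⟨hp, hxx⟩ := hcond (1, 0)
  obtain ⟨hq, hyy⟩ := hcond (0, 1)
  obtain ⟨-, hnn⟩ := hcond (-pd2 v z, pd1 v z)
  have hbasis : ((-pd2 v z, pd1 v z) : ℝ × ℝ)
      = (-pd2 v z) • ((1, 0) : ℝ × ℝ) + (pd1 v z) • ((0, 1) : ℝ × ℝ) := by
    ext <;> simp
  have hexpand : fderiv ℝ (fderiv ℝ v) z (-pd2 v z, pd1 v z) (-pd2 v z, pd1 v z)
      = pd2 v z ^ 2 * pd1 (pd1 v) z - 2 * pd1 v z * pd2 v z * pd2 (pd1 v) z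
        + pd1 v z ^ 2 * pd2 (pd2 v) z := by
    rw [hbasis, h₁₁, h₁₂, h₂₂]
    simp only [map_add, map_smul, add_apply, smul_apply,
      smul_eq_mul, hsymm]
    ring
  rw [hexpand] at hnn
  rw [← h₁₁] at hxx
  rw [← h₂₂] at hyy
  have hp' : pd1 v z = -((z.1 - c.1) / √(circlePower c s z)) := by
    unfold pd1; simp only [mul_one, mul_zero, add_zero] at hp; linarith
  have hq' : pd2 v z = -((z.2 - c.2) / √(circlePower c s z)) := by
    unfold pd2; simp only [mul_one, mul_zero, zero_add] at hq; linarith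
  generalize pd1 (pd1 v) z = vxx at *
  generalize pd2 (pd1 v) z = vxy at *
  generalize pd2 (pd2 v) z = vyy at *
  have hbarrier : ((1 : ℝ) ^ 2 + 0 ^ 2) / √(circlePower c s z)
        - ((z.1 - c.1) * 1 + (z.2 - c.2) * 0) ^ 2 / √(circlePower c s z) ^ 3
      + (((0 : ℝ) ^ 2 + 1 ^ 2) / √(circlePower c s z)
        - ((z.1 - c.1) * 0 + (z.2 - c.2) * 1) ^ 2 / √(circlePower c s z) ^ 3)
      + (((-pd2 v z) ^ 2 + pd1 v z ^ 2) / √(circlePower c s z)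
        - ((z.1 - c.1) * (-pd2 v z) + (z.2 - c.2) * pd1 v z) ^ 2 / √(circlePower c s z) ^ 3)
      = 2 / √(circlePower c s z) := by
    rw [hp', hq']
    field_simp
    ring
  have : 0 < 2 / √(circlePower c s z) := by positivity
  simp only at hxx hyy hnn
  linarith

/-- A function differentiable at a point `z` of a circle cannot touch a translate of
`-√(circlePower c s)` from below at `z` within the exterior of the circle, because the latter has
infinite slope there. -/
lemma not_isLocalMaxOn_add_sqrt_circlePower {v : ℝ × ℝ → ℝ} {c z : ℝ × ℝ} {s : ℝ} (hs : 0 < s)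
    (hv : DifferentiableAt ℝ v z) (hz : circlePower c s z = 0) :
    ¬ IsLocalMaxOn (fun y => v y + √(circlePower c s y)) {y | 0 ≤ circlePower c s y} z := by
  intro hmax
  have hγ0 : z + (0 : ℝ) • (z - c) = z := by simp
  have hpow : ∀ t : ℝ, circlePower c s (z + t • (z - c)) = s * (2 * t + t ^ 2) := by
    intro t
    have hz' : (z.1 - c.1) ^ 2 + (z.2 - c.2) ^ 2 = s := by
      unfold circlePower at hz; linarith
    rw [circlePower_add_smul, hz, ← hz']
    simp only [Prod.fst_sub, Prod.snd_sub]
    ring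
  have hline : HasDerivAt (fun t : ℝ => v (z + t • (z - c))) (fderiv ℝ v z (z - c)) 0 := by
    have hv' : HasFDerivAt v (fderiv ℝ v z) (z + (0 : ℝ) • (z - c)) := by
      rw [hγ0]; exact hv.hasFDerivAt
    exact hv'.comp_hasDerivAt (0 : ℝ) (hasDerivAt_add_smul z (z - c) 0)
  obtain ⟨C, hC0, hC⟩ : ∃ C : ℝ, 0 < C ∧ ∀ᶠ t in nhds (0 : ℝ),
      |v (z + t • (z - c)) - v z| ≤ C * |t| := by
    obtain ⟨C, hC0, hC⟩ := hline.isBigO_sub.exists_pos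
    exact ⟨C, hC0, by simpa [hγ0] using hC.bound⟩
  have hmax' : ∀ᶠ t in nhdsWithin (0 : ℝ) (Ioi 0),
      v (z + t • (z - c)) + √(circlePower c s (z + t • (z - c))) ≤ v z := by
    have htend : Tendsto (fun t : ℝ => z + t • (z - c)) (nhdsWithin 0 (Ioi 0))
        (nhdsWithin z {y | 0 ≤ circlePower c s y}) := by
      refine tendsto_nhdsWithin_iff.mpr
        ⟨(tendsto_add_smul_nhds_zero z (z - c)).mono_left nhdsWithin_le_nhds, ?_⟩
      filter_upwards [self_mem_nhdsWithin] with t ht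
      have ht' : 0 < t := ht
      rw [hpow]
      positivity
    filter_upwards [htend.eventually hmax] with t ht
    simpa [hz] using ht
  have hsmall : ∀ᶠ t in nhdsWithin (0 : ℝ) (Ioi 0), t < s / C ^ 2 :=
    nhdsWithin_le_nhds (eventually_lt_nhds (by positivity))
  obtain ⟨t, hle, hbound, hlt, ht⟩ :=
    (hmax'.and ((hC.filter_mono nhdsWithin_le_nhds).and (hsmall.and self_mem_nhdsWithin))).exists
  have ht' : 0 < t := ht
  rw [hpow] at hle
  rw [abs_of_pos ht'] at hbound
  have hroot : √(s * (2 * t + t ^ 2)) ≤ C * t := by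
    linarith [(abs_le.mp hbound).1]
  have hsq : s * (2 * t + t ^ 2) ≤ (C * t) ^ 2 := (sqrt_le_left (by positivity)).mp hroot
  rw [lt_div_iff₀ (by positivity)] at hlt
  nlinarith [mul_pos hs ht', mul_pos hs (pow_pos ht' 2), mul_lt_mul_of_pos_left hlt ht']

/-- Polar coordinates centered at the direction `α`, with the angle given by `Complex.arg`. -/
lemma eq_polar (α : ℝ) (z : ℝ × ℝ) {ζ : ℂ}
    (hζ : ζ = ⟨z.1 * cos α + z.2 * sin α, z.2 * cos α - z.1 * sin α⟩) :
    z = (‖ζ‖ * cos (α + ζ.arg), ‖ζ‖ * sin (α + ζ.arg)) ∧ ‖ζ‖ ^ 2 = z.1 ^ 2 + z.2 ^ 2 := by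
  have hre := Complex.norm_mul_cos_arg ζ
  have him := Complex.norm_mul_sin_arg ζ
  have hunit := sin_sq_add_cos_sq α
  have hre' : ζ.re = z.1 * cos α + z.2 * sin α := by rw [hζ]
  have him' : ζ.im = z.2 * cos α - z.1 * sin α := by rw [hζ]
  refine ⟨Prod.ext ?_ ?_, ?_⟩
  · have : ‖ζ‖ * cos (α + ζ.arg) = cos α * (‖ζ‖ * cos ζ.arg) - sin α * (‖ζ‖ * sin ζ.arg) := by
      rw [cos_add]; ring
    simp only [this, hre, him, hre', him']
    linear_combination -z.1 * hunit
  · have : ‖ζ‖ * sin (α + ζ.arg) = sin α * (‖ζ‖ * cos ζ.arg) + cos α * (‖ζ‖ * sin ζ.arg) := by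
      rw [sin_add]; ring
    simp only [this, hre, him, hre', him']
    linear_combination -z.2 * hunit
  · rw [Complex.sq_norm, Complex.normSq_apply, hre', him']
    linear_combination (z.1 ^ 2 + z.2 ^ 2) * hunit

lemma slitDisk_mem_nhds {ρ₀ α : ℝ} (hρ₀ : 0 < ρ₀) {z : ℝ × ℝ} (hz : z.1 ^ 2 + z.2 ^ 2 < ρ₀ ^ 2)
    (hslit : 0 < z.1 * cos α + z.2 * sin α ∨ z.2 * cos α - z.1 * sin α ≠ 0) :
    slitDisk ρ₀ α ∈ nhds z := by
  let rot : ℝ × ℝ → ℂ := fun y => ⟨y.1 * cos α + y.2 * sin α, y.2 * cos α - y.1 * sin α⟩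
  have hopen : IsOpen {y : ℝ × ℝ | y.1 ^ 2 + y.2 ^ 2 < ρ₀ ^ 2 ∧
      (0 < y.1 * cos α + y.2 * sin α ∨ y.2 * cos α - y.1 * sin α ≠ 0)} := by
    simp only [ofPred_and, ofPred_or]
    exact (isOpen_lt (by fun_prop) (by fun_prop)).inter
      ((isOpen_lt (by fun_prop) (by fun_prop)).union (isOpen_ne_fun (by fun_prop) (by fun_prop)))
  refine mem_of_superset (hopen.mem_nhds ⟨hz, hslit⟩) ?_
  rintro y ⟨hy, hyslit⟩
  obtain ⟨hpolar, hnorm⟩ := eq_polar α y (ζ := rot y) rfl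
  have hmem : rot y ∈ Complex.slitPlane := hyslit
  have harg := Complex.mem_slitPlane_iff_arg.mp hmem
  refine ⟨‖rot y‖, α + (rot y).arg, norm_pos_iff.mpr harg.2, ?_, ?_, ?_, hpolar⟩
  · exact lt_of_pow_lt_pow_left₀ 2 hρ₀.le (hnorm ▸ hy)
  · linarith [Complex.neg_pi_lt_arg (rot y)]
  · linarith [lt_of_le_of_ne (Complex.arg_le_pi (rot y)) harg.1]

lemma exists_angle_of_neg_half_le {d α : ℝ} (hd : 0 < d) {z : ℝ × ℝ}
    (hz : z.1 ^ 2 + z.2 ^ 2 = d ^ 2) (hside : -(d / 2) ≤ z.1 * cos α + z.2 * sin α) :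
    ∃ φ ∈ Icc (α - 3 * π / 4) (α + 3 * π / 4), z = (d * cos φ, d * sin φ) := by
  obtain ⟨ζ, hζ⟩ : ∃ ζ : ℂ,
    ζ = ⟨z.1 * cos α + z.2 * sin α, z.2 * cos α - z.1 * sin α⟩ := ⟨_, rfl⟩
  obtain ⟨hpolar, hnorm⟩ := eq_polar α z hζ
  have hnorm' : ‖ζ‖ = d :=
    (pow_left_inj₀ (norm_nonneg ζ) hd.le two_ne_zero).mp (hnorm.trans hz)
  have hcos : -(1 / 2) ≤ cos ζ.arg := by
    have h := Complex.norm_mul_cos_arg ζ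
    have hre : ζ.re = z.1 * cos α + z.2 * sin α := by rw [hζ]
    rw [hnorm', hre] at h
    nlinarith
  have harg : |ζ.arg| ≤ 3 * π / 4 := by
    by_contra! hlt
    have hmono : cos |ζ.arg| < cos (2 * π / 3) :=
      cos_lt_cos_of_nonneg_of_le_pi (by positivity) (Complex.abs_arg_le_pi ζ)
        (by linarith [pi_pos])
    rw [cos_abs, show 2 * π / 3 = π - π / 3 by ring, cos_pi_sub, cos_pi_div_three] at hmono
    linarith
  rw [hnorm'] at hpolar
  obtain ⟨h₁, h₂⟩ := abs_le.mp harg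
  exact ⟨α + ζ.arg, ⟨by linarith, by linarith⟩, hpolar⟩

lemma IsMSESolution.neg {U : Set (ℝ × ℝ)} {v : ℝ × ℝ → ℝ} (hv : IsMSESolution U v) :
    IsMSESolution U (-v) := by
  have h₁ : ∀ u : ℝ × ℝ → ℝ, pd1 (-u) = -pd1 u := by
    intro u; ext z; simp [pd1, fderiv_neg]
  have h₂ : ∀ u : ℝ × ℝ → ℝ, pd2 (-u) = -pd2 u := by
    intro u; ext z; simp [pd2, fderiv_neg]
  refine ⟨hv.1.neg, fun z hz => ?_⟩
  simp only [h₁, h₂, Pi.neg_apply]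
  linear_combination -hv.2 z hz

/-- On the bisecting ray, a solution on a slit disk is bounded, up to twice the radius `d`, by one
of its values on the arc of radius `d` away from the slit. -/
lemma IsMSESolution.exists_le_add_on_arc {ρ₀ d α ρ : ℝ} {v : ℝ × ℝ → ℝ} (hd : 0 < d)
    (hdρ₀ : d < ρ₀) (hv : IsMSESolution (slitDisk ρ₀ α) v) (hρ : 0 < ρ) (hρd : ρ < d) :
    ∃ φ ∈ Icc (α - 3 * π / 4) (α + 3 * π / 4),
      v (ρ * cos α, ρ * sin α) ≤ v (d * cos φ, d * sin φ) + 2 * d := by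
  have hunit := sin_sq_add_cos_sq α
  set c : ℝ × ℝ := (-(d * cos α), -(d * sin α)) with hc
  set s : ℝ := d ^ 2 + ρ ^ 2 with hs
  have hpow : ∀ z : ℝ × ℝ, circlePower c s z
      = z.1 ^ 2 + z.2 ^ 2 + 2 * d * (z.1 * cos α + z.2 * sin α) - ρ ^ 2 := by
    intro z
    simp only [circlePower, hc, hs]
    linear_combination d ^ 2 * hunit
  have hlagrange : ∀ z : ℝ × ℝ, (z.1 * cos α + z.2 * sin α) ^ 2
      + (z.2 * cos α - z.1 * sin α) ^ 2 = z.1 ^ 2 + z.2 ^ 2 := by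
    intro z
    linear_combination (z.1 ^ 2 + z.2 ^ 2) * hunit
  set K : Set (ℝ × ℝ) := {z | z.1 ^ 2 + z.2 ^ 2 ≤ d ^ 2} ∩ {z | 0 ≤ circlePower c s z} with hK
  have hKcompact : IsCompact K := by
    refine (isCompact_Icc (a := ((-d, -d) : ℝ × ℝ)) (b := (d, d))).of_isClosed_subset
      ((isClosed_le (by fun_prop) (by fun_prop)).inter
        (isClosed_le continuous_const (continuous_circlePower c s))) ?_
    rintro z ⟨hz, -⟩
    have hz' : z.1 ^ 2 + z.2 ^ 2 ≤ d ^ 2 := hz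
    have h₁ := abs_le.mp (abs_le_of_sq_le_sq (by nlinarith [sq_nonneg z.2] : z.1 ^ 2 ≤ d ^ 2) hd.le)
    have h₂ := abs_le.mp (abs_le_of_sq_le_sq (by nlinarith [sq_nonneg z.1] : z.2 ^ 2 ≤ d ^ 2) hd.le)
    exact ⟨⟨h₁.1, h₂.1⟩, ⟨h₁.2, h₂.2⟩⟩
  have hKU : ∀ z ∈ K, slitDisk ρ₀ α ∈ nhds z := by
    rintro z ⟨hz, hz'⟩
    rw [mem_ofPred_eq] at hz hz'
    refine slitDisk_mem_nhds (hd.trans hdρ₀) (by nlinarith) ?_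
    by_contra! hslit
    have := hlagrange z
    rw [hpow] at hz'
    rw [hslit.2] at this
    nlinarith [pow_pos hρ 2, hslit.1]
  have hcont : ContinuousOn (fun y => v y + √(circlePower c s y)) K := fun z hz =>
    ((hv.1.contDiffAt (hKU z hz)).continuousAt.add
      (continuous_circlePower c s).sqrt.continuousAt).continuousWithinAt
  have hray : ((ρ * cos α, ρ * sin α) : ℝ × ℝ) ∈ K := by
    refine ⟨?_, ?_⟩
    · rw [mem_ofPred_eq]
      calc (ρ * cos α) ^ 2 + (ρ * sin α) ^ 2 = ρ ^ 2 := by linear_combination ρ ^ 2 * hunit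
        _ ≤ d ^ 2 := by gcongr
    · rw [mem_ofPred_eq, hpow]
      have : (ρ * cos α) ^ 2 + (ρ * sin α) ^ 2 + 2 * d * (ρ * cos α * cos α + ρ * sin α * sin α)
          - ρ ^ 2 = 2 * d * ρ := by
        linear_combination (ρ ^ 2 + 2 * d * ρ) * hunit
      rw [this]
      positivity
  obtain ⟨z, hzK, hzmax⟩ := hKcompact.exists_isMaxOn ⟨_, hray⟩ hcont
  have hz₁ : z.1 ^ 2 + z.2 ^ 2 ≤ d ^ 2 := hzK.1
  have hz₂ : 0 ≤ circlePower c s z := hzK.2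
  have hzd : z.1 ^ 2 + z.2 ^ 2 = d ^ 2 := by
    refine hz₁.eq_of_not_lt fun hlt => ?_
    have hball : {y : ℝ × ℝ | y.1 ^ 2 + y.2 ^ 2 ≤ d ^ 2} ∈ nhds z := by
      have hopen : IsOpen {y : ℝ × ℝ | y.1 ^ 2 + y.2 ^ 2 < d ^ 2} :=
        isOpen_lt (by fun_prop) (by fun_prop)
      exact mem_of_superset (hopen.mem_nhds hlt) (ofPred_subset_ofPred.mpr fun y hy => hy.le)
    have hlocal : IsLocalMaxOn (fun y => v y + √(circlePower c s y))
        {y | 0 ≤ circlePower c s y} z :=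
      hzmax.filter_mono (le_principal_iff.mpr (inter_mem (mem_nhdsWithin_of_mem_nhds hball)
        self_mem_nhdsWithin))
    rcases hz₂.eq_or_lt with hzero | hpos
    · exact not_isLocalMaxOn_add_sqrt_circlePower (by positivity)
        ((hv.1.contDiffAt (hKU z hzK)).differentiableAt (by simp)) hzero.symm hlocal
    · refine not_isLocalMax_add_sqrt_circlePower hv (hKU z hzK) hpos (hlocal.isLocalMax ?_)
      filter_upwards [(continuous_circlePower c s).continuousAt.eventually_const_lt hpos]
        with y hy using hy.le
  rw [hpow, hzd] at hz₂
  obtain ⟨φ, hφ, hzφ⟩ := exists_angle_of_neg_half_le (α := α) hd hzd (by nlinarith)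
  refine ⟨φ, hφ, ?_⟩
  have hroot : √(circlePower c s z) ≤ 2 * d := by
    refine (sqrt_le_left (by positivity)).mpr ?_
    rw [hpow, hzd]
    have hle : z.1 * cos α + z.2 * sin α ≤ d :=
      le_of_abs_le (abs_le_of_sq_le_sq
        (by nlinarith [hlagrange z, sq_nonneg (z.2 * cos α - z.1 * sin α)]) hd.le)
    nlinarith [sq_nonneg ρ]
  have hle : v (ρ * cos α, ρ * sin α) + √(circlePower c s (ρ * cos α, ρ * sin α))
      ≤ v z + √(circlePower c s z) := hzmax hray
  rw [← hzφ]
  linarith [sqrt_nonneg (circlePower c s (ρ * cos α, ρ * sin α))]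

/-- **Uniform interior bound along a ray for solutions of the MSE on a slit disk**
(Proposition `major` of the paper): for every `ε > 0` there is `d ∈ (0,ρ₀)` such that
every solution `v` of the MSE on the slit disk satisfies, along the ray of direction
`(cos α, sin α)`, the two-sided bound by the sup/inf of `v` on the region
`{ d ≤ ρ' < ρ₀, |φ − α| ≤ 3π/4 }` up to `ε` (sup and inf taken in the extended reals). -/
theorem stmt_3 (ρ₀ ε : ℝ) (hρ₀ : 0 < ρ₀) (hε : 0 < ε) :
    ∃ d : ℝ, 0 < d ∧ d < ρ₀ ∧ ∀ (α : ℝ) (v : ℝ × ℝ → ℝ),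
      IsMSESolution (slitDisk ρ₀ α) v →
      ∀ ρ : ℝ, 0 < ρ → ρ < ρ₀ →
        ((v (ρ * Real.cos α, ρ * Real.sin α) : EReal) ≤
          (⨆ ρ' ∈ Set.Ico d ρ₀, ⨆ φ ∈ Set.Icc (α - 3 * π / 4) (α + 3 * π / 4),
            ((v (ρ' * Real.cos φ, ρ' * Real.sin φ) : EReal))) + (ε : EReal)) ∧
        ((⨅ ρ' ∈ Set.Ico d ρ₀, ⨅ φ ∈ Set.Icc (α - 3 * π / 4) (α + 3 * π / 4),
            ((v (ρ' * Real.cos φ, ρ' * Real.sin φ) : EReal))) - (ε : EReal) ≤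
          (v (ρ * Real.cos α, ρ * Real.sin α) : EReal)) := by
  set d := min (ρ₀ / 2) (ε / 2) with hd_def
  have hd : 0 < d := by positivity
  have hdρ₀ : d < ρ₀ := by linarith [min_le_left (ρ₀ / 2) (ε / 2)]
  have hdε : 2 * d ≤ ε := by linarith [min_le_right (ρ₀ / 2) (ε / 2)]
  have hbound : ∀ (α : ℝ) (v : ℝ × ℝ → ℝ), IsMSESolution (slitDisk ρ₀ α) v →
      ∀ ρ : ℝ, 0 < ρ → ρ < ρ₀ → ∃ ρ' ∈ Ico d ρ₀, ∃ φ ∈ Icc (α - 3 * π / 4) (α + 3 * π / 4),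
        v (ρ * cos α, ρ * sin α) ≤ v (ρ' * cos φ, ρ' * sin φ) + ε := by
    intro α v hv ρ hρ hρρ₀
    rcases lt_or_ge ρ d with hlt | hge
    · obtain ⟨φ, hφ, hle⟩ := hv.exists_le_add_on_arc hd hdρ₀ hρ hlt
      exact ⟨d, ⟨le_rfl, hdρ₀⟩, φ, hφ, by linarith⟩
    · exact ⟨ρ, ⟨hge, hρρ₀⟩, α, ⟨by linarith [pi_pos], by linarith [pi_pos]⟩, by linarith⟩
  refine ⟨d, hd, hdρ₀, fun α v hv ρ hρ hρρ₀ => ⟨?_, ?_⟩⟩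
  · obtain ⟨ρ', hρ', φ, hφ, hle⟩ := hbound α v hv ρ hρ hρρ₀
    calc (v (ρ * cos α, ρ * sin α) : EReal)
        ≤ (v (ρ' * cos φ, ρ' * sin φ) : EReal) + (ε : EReal) := mod_cast hle
      _ ≤ _ := by
        gcongr
        exact le_iSup₂_of_le ρ' hρ' (le_iSup₂_of_le φ hφ le_rfl)
  · obtain ⟨ρ', hρ', φ, hφ, hle⟩ := hbound α (-v) hv.neg ρ hρ hρρ₀
    calc _ ≤ (v (ρ' * cos φ, ρ' * sin φ) : EReal) - (ε : EReal) := by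
          refine EReal.sub_le_sub ?_ le_rfl
          exact iInf₂_le_of_le ρ' hρ' (iInf₂_le_of_le φ hφ le_rfl)
      _ ≤ (v (ρ * cos α, ρ * sin α) : EReal) := by
        rw [← EReal.coe_sub]
        simp only [Pi.neg_apply] at hle
        exact mod_cast (by linarith :
          v (ρ' * cos φ, ρ' * sin φ) - ε ≤ v (ρ * cos α, ρ * sin α))
end
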